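/- Hartogs extension theorem: Let n > 1, let Ω be a domain (connected open set) in M^n ≅ ℝ^{(m+1)n}, and let K ⊂ Ω be a compact set such that Ω ∖ K is connected. Then every left monogenic function f : Ω ∖ K → 𝔸 extends to a left monogenic function on Ω; that is, there exists a left monogenic F : Ω → 𝔸 with F = f on Ω ∖ K. -/

import Mathlib

open MeasureTheory

noncomputable section

/-- A real alternative `*`-algebra of finite dimension `> 1`, with a fixed
hypercomplex basis `v 0 = 1, v 1, …, v m` spanning the hypercomplex subspace `M`.
Multiplication is `ℝ`-bilinear (bundled as a linear map). -/
structure HCAlg (𝔸 : Type) [NormedAddCommGroup 𝔸] [NormedSpace ℝ 𝔸] (m : ℕ) : Type where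
  mul : 𝔸 →ₗ[ℝ] 𝔸 →ₗ[ℝ] 𝔸
  one : 𝔸
  conj : 𝔸 →ₗ[ℝ] 𝔸
  findim : FiniteDimensional ℝ 𝔸
  dim_gt_one : 1 < Module.finrank ℝ 𝔸
  one_mul' : ∀ a, mul one a = a
  mul_one' : ∀ a, mul a one = a
  alt_left : ∀ a b, mul a (mul a b) = mul (mul a a) b
  alt_right : ∀ a b, mul (mul b a) a = mul b (mul a a)
  conj_invol : ∀ a, conj (conj a) = a
  conj_mul' : ∀ a b, conj (mul a b) = mul (conj b) (conj a)
  conj_one : conj one = one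
  hm : 1 ≤ m
  v : Fin (m + 1) → 𝔸
  v_indep : LinearIndependent ℝ v
  v_zero : v 0 = one
  v_trace : ∀ s, s ≠ 0 → v s + conj (v s) = 0
  v_norm : ∀ s, s ≠ 0 → mul (v s) (conj (v s)) = one
  v_anticomm : ∀ s t, s ≠ 0 → t ≠ 0 → s ≠ t → mul (v s) (v t) = -(mul (v t) (v s))

variable {𝔸 : Type} [NormedAddCommGroup 𝔸] [NormedSpace ℝ 𝔸] {m n : ℕ}

/-- `M^n`, identified with `ℝ^{(m+1)n}` via the coordinates `x j s`. -/
abbrev Mn (n m : ℕ) := Fin n → Fin (m + 1) → ℝ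

/-- Euclidean norm of a point of `M` (in coordinates). -/
def enormM (c : Fin (m + 1) → ℝ) : ℝ := Real.sqrt (∑ s, c s ^ 2)

/-- Euclidean norm of a point of `M^n` (in coordinates). -/
def enormMn (x : Mn n m) : ℝ := Real.sqrt (∑ j, ∑ s, x j s ^ 2)

/-- Partial derivative `∂f/∂x_{j,s}` for functions on `M^n`. -/
def pd {E : Type} [NormedAddCommGroup E] [NormedSpace ℝ E]
    (f : Mn n m → E) (j : Fin n) (s : Fin (m + 1)) (x : Mn n m) : E :=
  fderiv ℝ f x (Pi.single j (Pi.single s 1))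

/-- Partial derivative `∂f/∂x_s` for functions on `M`. -/
def pd1 {E : Type} [NormedAddCommGroup E] [NormedSpace ℝ E]
    (f : (Fin (m + 1) → ℝ) → E) (s : Fin (m + 1)) (x : Fin (m + 1) → ℝ) : E :=
  fderiv ℝ f x (Pi.single s 1)

/-- The Dirac (Cauchy–Riemann) operator `∂̄_j = ∑_s v_s ∂/∂x_{j,s}`. -/
def dbar (H : HCAlg 𝔸 m) (f : Mn n m → 𝔸) (j : Fin n) (x : Mn n m) : 𝔸 :=
  ∑ s, H.mul (H.v s) (pd f j s x)

/-- The conjugated Dirac operator `∂_j = ∑_s v_s^c ∂/∂x_{j,s}`. -/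
def dconj (H : HCAlg 𝔸 m) (f : Mn n m → 𝔸) (j : Fin n) (x : Mn n m) : 𝔸 :=
  ∑ s, H.mul (H.conj (H.v s)) (pd f j s x)

/-- The Laplacian `Δ_j = ∑_s ∂²/∂x_{j,s}²` in the `j`-th block of variables. -/
def lap {E : Type} [NormedAddCommGroup E] [NormedSpace ℝ E]
    (f : Mn n m → E) (j : Fin n) (x : Mn n m) : E :=
  ∑ s, pd (pd f j s) j s x

/-- Surface area of the unit `(N-1)`-sphere in `ℝ^N`: `σ_N = 2 π^{N/2} / Γ(N/2)`. -/
def usigma (N : ℕ) : ℝ := 2 * Real.pi ^ ((N : ℝ) / 2) / Real.Gamma ((N : ℝ) / 2)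

/-- Embedding of coordinates into the hypercomplex subspace `M ⊆ 𝔸`. -/
def embM (H : HCAlg 𝔸 m) (c : Fin (m + 1) → ℝ) : 𝔸 := ∑ s, c s • H.v s

/-- The Cauchy kernel `E(x) = σ_{m+1}⁻¹ x^c / |x|^{m+1}` on `M`. -/
def CauchyE (H : HCAlg 𝔸 m) (c : Fin (m + 1) → ℝ) : 𝔸 :=
  (usigma (m + 1) * enormM c ^ (m + 1))⁻¹ • H.conj (embM H c)

/-- The Bochner–Martinelli kernel components `K_j(x) = σ_N⁻¹ x_j^c / |x|^N`, `N = (m+1)n`. -/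
def Kker (H : HCAlg 𝔸 m) (n : ℕ) (j : Fin n) (x : Mn n m) : 𝔸 :=
  (usigma ((m + 1) * n) * enormMn x ^ ((m + 1) * n))⁻¹ • H.conj (embM H (x j))

/-- `Tsol g (x) = −∫_M E(y₁ − x₁) (g(y₁, x⁰)) dV(y₁)`. -/
def Tsol (H : HCAlg 𝔸 m) (hn : 0 < n) (g : Mn n m → 𝔸) (x : Mn n m) : 𝔸 :=
  - ∫ y1 : Fin (m + 1) → ℝ,
      H.mul (CauchyE H (y1 - x ⟨0, hn⟩)) (g (Function.update x ⟨0, hn⟩ y1))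

/-- `Fint g (x) = ∫_M E(y₁) (g(y₁ + x₁, x⁰)) dV(y₁)`. -/
def Fint (H : HCAlg 𝔸 m) (hn : 0 < n) (g : Mn n m → 𝔸) (x : Mn n m) : 𝔸 :=
  ∫ y1 : Fin (m + 1) → ℝ,
      H.mul (CauchyE H y1) (g (Function.update x ⟨0, hn⟩ (y1 + x ⟨0, hn⟩)))


section

open Set Metric Filter
open scoped Topology ContDiff Manifold

section Calculus

variable {E P W : Type} [NormedAddCommGroup E] [NormedSpace ℝ E] [FiniteDimensional ℝ E]
  [NormedAddCommGroup P] [NormedSpace ℝ P] [FiniteDimensional ℝ P]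
  [NormedAddCommGroup W] [NormedSpace ℝ W]

/-- A `C^k` function on an open set agrees, near a given compact subset, with a globally defined
`C^k` function with compact support contained in the open set. -/
lemma exists_contDiff_extension {k : ℕ∞} {f : E → W} {U C : Set E} (hU : IsOpen U)
    (hC : IsCompact C) (hCU : C ⊆ U) (hf : ContDiffOn ℝ k f U) :
    ∃ u : E → W, ContDiff ℝ k u ∧ HasCompactSupport u ∧ tsupport u ⊆ U ∧
      ∃ V, IsOpen V ∧ C ⊆ V ∧ V ⊆ U ∧ EqOn u f V := by
  obtain ⟨L, hL, hCL, hLU⟩ := exists_compact_between hC hU hCU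
  obtain ⟨χ, h1, h0, -⟩ := exists_contMDiffMap_one_nhds_of_subset_interior (n := k) 𝓘(ℝ, E)
    hC.isClosed hCL
  have hχ : ContDiff ℝ k χ := χ.contMDiff.contDiff
  have hsupp : tsupport χ ⊆ L := by
    refine closure_minimal (fun x hx => ?_) hL.isClosed
    by_contra h
    exact hx (h0 x h)
  obtain ⟨V, hV, hCV, hV1⟩ := eventually_nhdsSet_iff_exists.1 h1
  have hts : tsupport (fun x => χ x • f x) ⊆ tsupport χ := tsupport_smul_subset_left _ _
  refine ⟨fun x => χ x • f x, ?_, ?_, (hts.trans hsupp).trans hLU, V ∩ U, hV.inter hU,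
    subset_inter hCV hCU, inter_subset_right, fun x hx => by simp [hV1 x hx.1]⟩
  · rw [contDiff_iff_contDiffAt]
    intro x
    by_cases hx : x ∈ U
    · exact hχ.contDiffAt.smul (hf.contDiffAt (hU.mem_nhds hx))
    · have : (fun x => χ x • f x) =ᶠ[𝓝 x] 0 :=
        notMem_tsupport_iff_eventuallyEq.1 fun h => hx (hLU (hsupp (hts h)))
      exact contDiffAt_const.congr_of_eventuallyEq this
  · exact HasCompactSupport.intro hL fun x hx => by simp [h0 x hx]

variable [MeasurableSpace E] [BorelSpace E] (μ : Measure E) [IsFiniteMeasureOnCompacts μ]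

/-- Differentiation under the integral sign for `C^1` integrands which locally uniformly have
compact support in the integration variable. -/
lemma hasFDerivAt_integral_of_contDiff {Φ : P → E → W}
    (hΦ : ContDiff ℝ 1 (fun q : P × E => Φ q.1 q.2)) {x₀ : P} {C : Set E} (hC : IsCompact C)
    (h0 : ∀ᶠ x in 𝓝 x₀, ∀ y, y ∉ C → Φ x y = 0) :
    HasFDerivAt (fun x => ∫ y, Φ x y ∂μ) (∫ y, fderiv ℝ (fun x => Φ x y) x₀ ∂μ) x₀ := by
  set Φ' : P → E → P →L[ℝ] W := fun x y => fderiv ℝ (fun x => Φ x y) x with hΦ'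
  have hd : ∀ x y, HasFDerivAt (fun x => Φ x y) (Φ' x y) x := fun x y =>
    (DifferentiableAt.hasFDerivAt (by
      have : Differentiable ℝ (fun x => Φ x y) :=
        (hΦ.comp (contDiff_id.prodMk contDiff_const)).differentiable one_ne_zero
      exact this x))
  have hΦ'c : Continuous (fun q : P × E => Φ' q.1 q.2) := by
    have : (fun q : P × E => Φ' q.1 q.2) = fun q => (fderiv ℝ (fun q : P × E => Φ q.1 q.2) q).comp
        (ContinuousLinearMap.inl ℝ P E) := by
      ext1 q
      have h1 : HasFDerivAt (fun q : P × E => Φ q.1 q.2)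
          (fderiv ℝ (fun q : P × E => Φ q.1 q.2) (q.1, q.2)) (q.1, q.2) :=
        ((hΦ.differentiable one_ne_zero) _).hasFDerivAt
      have h2 : HasFDerivAt (fun x : P => (x, q.2)) (ContinuousLinearMap.inl ℝ P E) q.1 :=
        hasFDerivAt_prodMk_left q.1 q.2
      exact (HasFDerivAt.comp (g := fun q : P × E => Φ q.1 q.2) q.1 h1 h2).fderiv
    rw [this]
    exact (hΦ.continuous_fderiv one_ne_zero).clm_comp continuous_const
  have hΦc : Continuous (fun q : P × E => Φ q.1 q.2) := hΦ.continuous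
  obtain ⟨r, hr, hball⟩ := Metric.eventually_nhds_iff_ball.1 h0
  have hz : ∀ x ∈ ball x₀ r, ∀ y, y ∉ C → Φ' x y = 0 := by
    intro x hx y hy
    have : (fun x => Φ x y) =ᶠ[𝓝 x] fun _ => 0 := by
      filter_upwards [isOpen_ball.mem_nhds hx] with z hz using hball z hz y hy
    simp only [hΦ', this.fderiv_eq]
    simp
  obtain ⟨M, hM⟩ := ((isCompact_closedBall x₀ r).prod hC).exists_bound_of_continuousOn
    hΦ'c.continuousOn
  have hx₀ : x₀ ∈ ball x₀ r := mem_ball_self hr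
  refine hasFDerivAt_integral_of_dominated_of_fderiv_le (ball_mem_nhds x₀ hr) (F' := Φ')
    (bound := C.indicator fun _ => M) ?_ ?_ ?_ ?_ ?_ ?_
  · exact Eventually.of_forall fun x =>
      (hΦc.comp (Continuous.prodMk_right x)).aestronglyMeasurable
  · exact (hΦc.comp (Continuous.prodMk_right x₀)).integrable_of_hasCompactSupport
      (HasCompactSupport.intro hC fun y hy => hball x₀ hx₀ y hy)
  · exact (hΦ'c.comp (Continuous.prodMk_right x₀)).aestronglyMeasurable
  · refine Eventually.of_forall fun y x hx => ?_
    by_cases hy : y ∈ C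
    · simpa [hy] using hM (x, y) ⟨ball_subset_closedBall hx, hy⟩
    · simp [hy, hz x hx y hy]
  · exact (integrable_indicator_iff hC.measurableSet).2 (integrableOn_const hC.measure_lt_top.ne)
  · exact Eventually.of_forall fun y x _ => hd x y

lemma exists_contDiff_primitive {a : ℝ → ℝ} (ha : ContDiff ℝ ∞ a) (s₀ : ℝ) :
    ∃ G : ℝ → ℝ, ContDiff ℝ ∞ G ∧ (∀ s, HasDerivAt G (a s) s) ∧
      ∀ s, G s = ∫ t in s₀..s, a t := by
  have hd : ∀ s, HasDerivAt (fun s => ∫ t in s₀..s, a t) (a s) s := fun s =>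
    intervalIntegral.integral_hasDerivAt_right (ha.continuous.intervalIntegrable _ _)
      (ha.continuous.stronglyMeasurableAtFilter _ _) ha.continuous.continuousAt
  refine ⟨_, ?_, hd, fun _ => rfl⟩
  rw [contDiff_infty_iff_deriv]
  exact ⟨fun s => (hd s).differentiableAt, by rwa [funext fun s => (hd s).deriv]⟩

/-- The radial profile of a smooth kernel agreeing with (the gradient of) the fundamental solution
of the Laplacian in dimension `d` away from the unit ball. -/
lemma exists_radial_profile (d : ℕ) :
    ∃ a : ℝ → ℝ, ContDiff ℝ ∞ a ∧ (∀ s, 1 ≤ s → 4 * s * deriv a s + 2 * d * a s = 0) ∧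
      (∀ s, 0 ≤ s → 0 ≤ 4 * s * deriv a s + 2 * d * a s) ∧
      ∃ s, 0 ≤ s ∧ 4 * s * deriv a s + 2 * d * a s ≠ 0 := by
  set θ : ℝ → ℝ := fun s => Real.smoothTransition (2 * s - 1) with hθ
  have hθc : ContDiff ℝ ∞ θ :=
    Real.smoothTransition.contDiff.comp ((contDiff_const.mul contDiff_id).sub contDiff_const)
  have hθ0 : ∀ s, s ≤ 1 / 2 → θ s = 0 := fun s hs =>
    Real.smoothTransition.zero_of_nonpos (by linarith)
  have hθ1 : ∀ s, 1 ≤ s → θ s = 1 := fun s hs =>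
    Real.smoothTransition.one_of_one_le (by linarith)
  have hmono : Monotone θ := fun s t h => Real.smoothTransition.monotone (by linarith)
  set a : ℝ → ℝ := fun s => θ s * s ^ (-(d : ℝ) / 2) with ha
  have hac : ContDiff ℝ ∞ a := by
    rw [contDiff_iff_contDiffAt]
    intro s
    rcases lt_or_ge s (1 / 2) with h | h
    · have : a =ᶠ[𝓝 s] fun _ => 0 := by
        filter_upwards [Iio_mem_nhds h] with t ht
        simp [ha, hθ0 t (le_of_lt ht)]
      exact contDiffAt_const.congr_of_eventuallyEq this
    · exact hθc.contDiffAt.mul (Real.contDiffAt_rpow_const_of_ne (by linarith))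
  have key : ∀ s, 0 < s → 4 * s * deriv a s + 2 * d * a s
      = 4 * s * (deriv θ s * s ^ (-(d : ℝ) / 2)) := by
    intro s hs
    have h1 : HasDerivAt θ (deriv θ s) s :=
      ((hθc.differentiable (by simp)) s).hasDerivAt
    have h2 := h1.mul (Real.hasDerivAt_rpow_const (p := -(d : ℝ) / 2) (Or.inl hs.ne'))
    have h3 : deriv a s = _ := h2.deriv
    rw [h3, Real.rpow_sub_one hs.ne']
    simp only [ha]
    field_simp
    ring
  have hpos : ∀ s, 0 ≤ deriv θ s := fun s => hmono.deriv_nonneg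
  refine ⟨a, hac, ?_, ?_, ?_⟩
  · intro s hs
    rw [key s (by linarith)]
    have hderiv1 : deriv θ s = 0 := by
      refine IsLocalMax.deriv_eq_zero (Eventually.of_forall fun t => ?_)
      rw [hθ1 s hs]
      exact Real.smoothTransition.le_one _
    simp [hderiv1]
  · intro s hs
    rcases hs.eq_or_lt with rfl | hs
    · simp [ha, hθ0]
    · rw [key s hs]
      have := hpos s
      positivity
  · by_contra! hcon
    have hz : ∀ s ∈ Ioo (1 / 4 : ℝ) 1, deriv θ s = 0 := by
      intro s hs
      have hs0 : 0 < s := by linarith [hs.1]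
      have h := hcon s hs0.le
      rw [key s hs0] at h
      have h4 : s ^ (-(d : ℝ) / 2) ≠ 0 := (Real.rpow_pos_of_pos hs0 _).ne'
      simpa [hs0.ne', h4] using h
    obtain ⟨c, hc, hc'⟩ := exists_deriv_eq_slope θ (a := 1 / 4) (b := 1) (by norm_num)
      hθc.continuous.continuousOn (hθc.differentiable (by simp)).differentiableOn
    rw [hz c hc, hθ0 (1 / 4) (by norm_num), hθ1 1 le_rfl] at hc'
    norm_num at hc'

end Calculus

section Laplacian

variable {E P W : Type} [NormedAddCommGroup E] [NormedSpace ℝ E]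
  [NormedAddCommGroup P] [NormedSpace ℝ P]
  [NormedAddCommGroup W] [NormedSpace ℝ W] {ι κ : Type} [Fintype ι] [Fintype κ]

/-- The sum of the second derivatives of `u` in the directions of a finite family `e`. -/
def lapFamily (e : ι → E) (u : E → W) (x : E) : W :=
  ∑ i, fderiv ℝ (fun z => fderiv ℝ u z (e i)) x (e i)

lemma ContDiff.fderiv_dir {u : E → W} (hu : ContDiff ℝ ∞ u) (v : E) :
    ContDiff ℝ ∞ fun x => fderiv ℝ u x v :=
  (hu.fderiv_right (m := ∞) (by simp)).clm_apply contDiff_const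

lemma ContDiffAt.fderiv_dir {u : E → W} {x : E} (hu : ContDiffAt ℝ ∞ u x) (v : E) :
    ContDiffAt ℝ ∞ (fun x => fderiv ℝ u x v) x :=
  (hu.fderiv_right (m := ∞) (by simp)).clm_apply contDiffAt_const

lemma ContDiff.lapFamily {u : E → W} (hu : ContDiff ℝ ∞ u) (e : ι → E) :
    ContDiff ℝ ∞ (lapFamily e u) :=
  ContDiff.sum fun i _ => (hu.fderiv_dir (e i)).fderiv_dir (e i)

lemma fderiv_dir_comm {u : E → W} {x : E} (hu : ContDiffAt ℝ ∞ u x) (v w : E) :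
    fderiv ℝ (fun z => fderiv ℝ u z v) x w = fderiv ℝ (fun z => fderiv ℝ u z w) x v := by
  have hd : DifferentiableAt ℝ (fderiv ℝ u) x :=
    (hu.fderiv_right (m := ∞) (by simp)).differentiableAt (by simp)
  have h (v w : E) : fderiv ℝ (fun z => fderiv ℝ u z v) x w = fderiv ℝ (fderiv ℝ u) x w v := by
    rw [fderiv_clm_apply hd (differentiableAt_const v)]
    simp
  rw [h, h]
  exact (hu.isSymmSndFDerivAt (by
    simp only [minSmoothness_of_isRCLikeNormedField]; exact ENat.LEInfty.out)) w v

lemma Filter.EventuallyEq.fderiv_dir {u w : E → W} {x : E} (h : u =ᶠ[𝓝 x] w) (v : E) :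
    (fun z => fderiv ℝ u z v) =ᶠ[𝓝 x] fun z => fderiv ℝ w z v := by
  filter_upwards [h.eventuallyEq_nhds] with z hz
  rw [hz.fderiv_eq]

lemma lapFamily_congr {u w : E → W} {x : E} (h : u =ᶠ[𝓝 x] w) (e : ι → E) :
    lapFamily e u x = lapFamily e w x :=
  Finset.sum_congr rfl fun i _ => by rw [(h.fderiv_dir (e i)).fderiv_eq]

lemma lapFamily_zero (e : ι → E) (x : E) : lapFamily e (fun _ => (0 : W)) x = 0 := by
  simp [lapFamily]

lemma fderiv_lapFamily {u : E → W} {x : E} (hu : ∀ᶠ z in 𝓝 x, ContDiffAt ℝ ∞ u z) (e : ι → E)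
    (v : E) : fderiv ℝ (lapFamily e u) x v = lapFamily e (fun z => fderiv ℝ u z v) x := by
  have hx := hu.self_of_nhds
  have h1 : fderiv ℝ (lapFamily e u) x v
      = ∑ i, fderiv ℝ (fun z => fderiv ℝ (fun z => fderiv ℝ u z (e i)) z (e i)) x v := by
    have : lapFamily e u = fun z => ∑ i, fderiv ℝ (fun z => fderiv ℝ u z (e i)) z (e i) := rfl
    rw [this, fderiv_fun_sum fun i _ =>
      (((hx.fderiv_dir (e i)).fderiv_dir (e i)).differentiableAt (by simp))]
    simp
  rw [h1]
  refine Finset.sum_congr rfl fun i _ => ?_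
  rw [fderiv_dir_comm (hx.fderiv_dir (e i))]
  have : (fun z => fderiv ℝ (fun z => fderiv ℝ u z (e i)) z v)
      =ᶠ[𝓝 x] fun z => fderiv ℝ (fun z => fderiv ℝ u z v) z (e i) := by
    filter_upwards [hu] with z hz using fderiv_dir_comm hz _ _
  rw [this.fderiv_eq]

lemma lapFamily_comm {u : E → W} (hu : ContDiff ℝ ∞ u) (e : ι → E) (e' : κ → E) (x : E) :
    lapFamily e (lapFamily e' u) x = lapFamily e' (lapFamily e u) x := by
  have h (v : E) : (fun z => fderiv ℝ (lapFamily e u) z v)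
      = lapFamily e fun z => fderiv ℝ u z v :=
    funext fun z => fderiv_lapFamily (Eventually.of_forall fun z => hu.contDiffAt) e v
  have h1 (w : E → W) (hw : ContDiff ℝ ∞ w) (z v : E) :
      fderiv ℝ (lapFamily e w) z v = lapFamily e (fun z => fderiv ℝ w z v) z :=
    fderiv_lapFamily (Eventually.of_forall fun z => hw.contDiffAt) e v
  have h2 : lapFamily e' (lapFamily e u) x
      = ∑ j, lapFamily e (fun z => fderiv ℝ (fun z => fderiv ℝ u z (e' j)) z (e' j)) x := by
    refine Finset.sum_congr rfl fun j _ => ?_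
    rw [h, h1 _ (hu.fderiv_dir _)]
  rw [h2]
  simp only [lapFamily]
  rw [Finset.sum_comm]
  refine Finset.sum_congr rfl fun i _ => ?_
  have hD (j : κ) : ContDiff ℝ ∞ fun z => fderiv ℝ (fun z => fderiv ℝ u z (e' j)) z (e' j) :=
    (hu.fderiv_dir _).fderiv_dir _
  have h3 : (fun z => fderiv ℝ (lapFamily e' u) z (e i))
      = fun z => ∑ j, fderiv ℝ (fun z => fderiv ℝ (fun z => fderiv ℝ u z (e' j)) z (e' j))
        z (e i) := by
    ext1 z
    have : lapFamily e' u = fun z => ∑ j, fderiv ℝ (fun z => fderiv ℝ u z (e' j)) z (e' j) := rfl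
    rw [this, fderiv_fun_sum fun j _ => (hD j).differentiable (by simp) z]
    simp
  rw [h3, fderiv_fun_sum fun j _ => ((hD j).fderiv_dir (e i)).differentiable (by simp) x]
  simp

/-- Smooth functions on a set that are annihilated by the Laplacian of a family. -/
def IsHarmonicFamily (e : ι → E) (u : E → W) (U : Set E) : Prop :=
  (∀ x ∈ U, ContDiffAt ℝ ∞ u x) ∧ ∀ x ∈ U, lapFamily e u x = 0

namespace IsHarmonicFamily

variable {e : ι → E} {u w : E → W} {U : Set E}

lemma mono {V : Set E} (h : IsHarmonicFamily e u U) (hV : V ⊆ U) : IsHarmonicFamily e u V :=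
  ⟨fun x hx => h.1 x (hV hx), fun x hx => h.2 x (hV hx)⟩

lemma congr (h : IsHarmonicFamily e u U) (hw : ∀ x ∈ U, w =ᶠ[𝓝 x] u) :
    IsHarmonicFamily e w U :=
  ⟨fun x hx => (h.1 x hx).congr_of_eventuallyEq (hw x hx), fun x hx => by
    rw [lapFamily_congr (hw x hx), h.2 x hx]⟩

lemma fderiv_dir (h : IsHarmonicFamily e u U) (hU : IsOpen U) (v : E) :
    IsHarmonicFamily e (fun x => fderiv ℝ u x v) U := by
  refine ⟨fun x hx => (h.1 x hx).fderiv_dir v, fun x hx => ?_⟩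
  have hev : ∀ᶠ z in 𝓝 x, z ∈ U := hU.mem_nhds hx
  rw [← fderiv_lapFamily (hev.mono h.1)]
  have : lapFamily e u =ᶠ[𝓝 x] fun _ => 0 := hev.mono h.2
  rw [this.fderiv_eq]
  simp

lemma sum {α : Type} [Fintype α] {f : α → E → W} (h : ∀ a, IsHarmonicFamily e (f a) U)
    (hU : IsOpen U) :
    IsHarmonicFamily e (fun x => ∑ a, f a x) U := by
  refine ⟨fun x hx => ContDiffAt.sum fun a _ => (h a).1 x hx, fun x hx => ?_⟩
  have h1 (i : ι) : (fun z => fderiv ℝ (fun x => ∑ a, f a x) z (e i))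
      =ᶠ[𝓝 x] fun z => ∑ a, fderiv ℝ (f a) z (e i) := by
    filter_upwards [hU.mem_nhds hx] with z hz
    rw [fderiv_fun_sum fun a _ => ((h a).1 z hz).differentiableAt (by simp)]
    simp
  have h2 : lapFamily e (fun x => ∑ a, f a x) x = ∑ a, lapFamily e (f a) x := by
    simp only [lapFamily]
    rw [Finset.sum_comm]
    refine Finset.sum_congr rfl fun i _ => ?_
    rw [(h1 i).fderiv_eq, fderiv_fun_sum fun a _ =>
      (((h a).1 x hx).fderiv_dir (e i)).differentiableAt (by simp)]
    simp
  rw [h2]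
  exact Finset.sum_eq_zero fun a _ => (h a).2 x hx

lemma clm_comp {W' : Type} [NormedAddCommGroup W'] [NormedSpace ℝ W']
    (h : IsHarmonicFamily e u U) (hU : IsOpen U) (L : W →L[ℝ] W') :
    IsHarmonicFamily e (fun x => L (u x)) U := by
  refine ⟨fun x hx => L.contDiff.contDiffAt.comp x (h.1 x hx), fun x hx => ?_⟩
  have hL {f : E → W} {z : E} (hf : ContDiffAt ℝ ∞ f z) (v : E) :
      fderiv ℝ (fun x => L (f x)) z v = L (fderiv ℝ f z v) := by
    have := (L.hasFDerivAt.comp z (hf.differentiableAt (by simp)).hasFDerivAt).fderiv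
    exact DFunLike.congr_fun this v
  have h1 (i : ι) : (fun z => fderiv ℝ (fun x => L (u x)) z (e i))
      =ᶠ[𝓝 x] fun z => L (fderiv ℝ u z (e i)) := by
    filter_upwards [hU.mem_nhds hx] with z hz using hL (h.1 z hz) _
  have h2 : lapFamily e (fun x => L (u x)) x = L (lapFamily e u x) := by
    simp only [lapFamily, map_sum]
    refine Finset.sum_congr rfl fun i _ => ?_
    rw [(h1 i).fderiv_eq, hL ((h.1 x hx).fderiv_dir (e i))]
  rw [h2, h.2 x hx, map_zero]

lemma add (h : IsHarmonicFamily e u U) (h' : IsHarmonicFamily e w U) (hU : IsOpen U) :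
    IsHarmonicFamily e (fun x => u x + w x) U := by
  have := sum (f := fun a : Bool => if a then u else w) (e := e) (U := U)
    (fun a => by cases a <;> simpa) hU
  simpa using this

lemma sub (h : IsHarmonicFamily e u U) (h' : IsHarmonicFamily e w U) (hU : IsOpen U) :
    IsHarmonicFamily e (fun x => u x - w x) U := by
  simpa [sub_eq_add_neg] using h.add (h'.clm_comp hU (-ContinuousLinearMap.id ℝ W)) hU

end IsHarmonicFamily

end Laplacian

section Kernel

variable {E : Type} [NormedAddCommGroup E] [NormedSpace ℝ E]
  {ι : Type} [Fintype ι]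

/-- The squared Euclidean norm with respect to a basis. -/
def sqNorm (b : Module.Basis ι ℝ E) (y : E) : ℝ := ∑ i, b.repr y i ^ 2

lemma sqNorm_nonneg (b : Module.Basis ι ℝ E) (y : E) : 0 ≤ sqNorm b y :=
  Finset.sum_nonneg fun _ _ => sq_nonneg _

lemma mem_closedBall_of_sqNorm_le_one (b : Module.Basis ι ℝ E) {y : E} (hy : sqNorm b y ≤ 1) :
    y ∈ closedBall (0 : E) (1 + ∑ i, ‖b i‖) := by
  rw [mem_closedBall_zero_iff, ← b.sum_repr y]
  have h : ‖∑ i, b.repr y i • b i‖ ≤ ∑ i, ‖b i‖ := by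
    refine (norm_sum_le _ _).trans (Finset.sum_le_sum fun i _ => ?_)
    rw [norm_smul]
    refine mul_le_of_le_one_left (norm_nonneg _) ?_
    rw [Real.norm_eq_abs, ← sq_le_one_iff_abs_le_one]
    exact (Finset.single_le_sum (f := fun i => b.repr y i ^ 2) (fun i _ => sq_nonneg _)
      (Finset.mem_univ i)).trans hy
  linarith

lemma exists_sqNorm_eq [Nonempty ι] (b : Module.Basis ι ℝ E) {s : ℝ} (hs : 0 ≤ s) :
    ∃ y, sqNorm b y = s := by
  classical
  obtain ⟨i⟩ := ‹Nonempty ι›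
  refine ⟨√s • b i, ?_⟩
  simp [sqNorm, Finsupp.single_apply, Real.sq_sqrt hs, ite_pow]

variable [FiniteDimensional ℝ E]

omit [Fintype ι] in
lemma contDiff_repr (b : Module.Basis ι ℝ E) (i : ι) : ContDiff ℝ ∞ fun y => b.repr y i :=
  (LinearMap.toContinuousLinearMap (b.coord i)).contDiff

omit [Fintype ι] in
lemma hasFDerivAt_repr (b : Module.Basis ι ℝ E) (i : ι) (y : E) :
    HasFDerivAt (fun y => b.repr y i) (LinearMap.toContinuousLinearMap (b.coord i)) y :=
  (LinearMap.toContinuousLinearMap (b.coord i)).hasFDerivAt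

lemma contDiff_sqNorm (b : Module.Basis ι ℝ E) : ContDiff ℝ ∞ (sqNorm b) :=
  ContDiff.sum fun i _ => (contDiff_repr b i).pow 2

lemma fderiv_sqNorm (b : Module.Basis ι ℝ E) (y : E) (i : ι) :
    fderiv ℝ (sqNorm b) y (b i) = 2 * b.repr y i := by
  classical
  have : HasFDerivAt (sqNorm b) (∑ i, (2 * b.repr y i ^ (2 - 1)) •
      LinearMap.toContinuousLinearMap (b.coord i)) y :=
    HasFDerivAt.fun_sum fun i _ => by simpa using (hasFDerivAt_repr b i y).pow 2
  rw [this.fderiv]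
  simp [Finsupp.single_apply]

lemma fderiv_comp_sqNorm (b : Module.Basis ι ℝ E) {G : ℝ → ℝ} {g : ℝ} {y : E}
    (hG : HasDerivAt G g (sqNorm b y)) (i : ι) :
    fderiv ℝ (fun y => G (sqNorm b y)) y (b i) = 2 * b.repr y i * g := by
  have h := hG.comp_hasFDerivAt y
    ((contDiff_sqNorm b).differentiable (by simp) y).hasFDerivAt
  have h' : fderiv ℝ (fun y => G (sqNorm b y)) y = _ := h.fderiv
  rw [h']
  simp [fderiv_sqNorm, mul_comm]

lemma lapFamily_comp_sqNorm (b : Module.Basis ι ℝ E) {G a : ℝ → ℝ}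
    (ha : ContDiff ℝ ∞ a) (hG : ∀ s, HasDerivAt G (a s) s) (y : E) :
    lapFamily b (fun y => G (sqNorm b y)) y
      = 4 * sqNorm b y * deriv a (sqNorm b y) + 2 * Fintype.card ι * a (sqNorm b y) := by
  classical
  have h1 (i : ι) : fderiv ℝ (fun z => fderiv ℝ (fun y => G (sqNorm b y)) z (b i)) y (b i)
      = 4 * deriv a (sqNorm b y) * b.repr y i ^ 2 + 2 * a (sqNorm b y) := by
    have e : (fun z => fderiv ℝ (fun y => G (sqNorm b y)) z (b i))
        = fun z => (2 * b.repr z i) * a (sqNorm b z) :=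
      funext fun z => fderiv_comp_sqNorm b (hG _) i
    have h2 : HasFDerivAt (fun z => 2 * b.repr z i) _ y := (hasFDerivAt_repr b i y).const_mul 2
    have h3 : HasFDerivAt (fun z => a (sqNorm b z)) (fderiv ℝ (fun z => a (sqNorm b z)) y) y :=
      ((ha.comp (contDiff_sqNorm b)).differentiable (by simp) y).hasFDerivAt
    rw [e, (h2.fun_mul h3).fderiv]
    have h4 := fderiv_comp_sqNorm b (y := y)
      ((ha.differentiable (by simp) (sqNorm b y)).hasDerivAt) i
    simp [h4]
    ring
  simp only [lapFamily, h1]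
  rw [Finset.sum_add_distrib, ← Finset.mul_sum]
  simp [sqNorm]
  ring

/-- A smooth kernel `N` whose Laplacian is a compactly supported mollifier of total mass one, such
that the vector field `y ↦ lapFamily b N y • y` is the gradient of a compactly supported function
`ψ`. -/
structure IsMeanKernel [MeasurableSpace E] (μ : Measure E) (b : Module.Basis ι ℝ E)
    (N ψ : E → ℝ) (R : ℝ) : Prop where
  pos : 0 < R
  contDiff : ContDiff ℝ ∞ N
  contDiff_grad : ContDiff ℝ ∞ ψ
  grad_eq_zero : ∀ y, y ∉ closedBall (0 : E) R → ψ y = 0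
  lap_eq_zero : ∀ y, y ∉ closedBall (0 : E) R → lapFamily b N y = 0
  fderiv_grad : ∀ i y, fderiv ℝ ψ y (b i) = b.repr y i * lapFamily b N y
  integral_lap : ∫ y, lapFamily b N y ∂μ = 1

lemma exists_isMeanKernel [Nonempty ι] [MeasurableSpace E] [BorelSpace E] (μ : Measure E)
    [μ.IsAddHaarMeasure] (b : Module.Basis ι ℝ E) :
    ∃ (N ψ : E → ℝ) (R : ℝ), IsMeanKernel μ b N ψ R := by
  obtain ⟨a, ha, ha1, hapos, s₁, hs₁, hs₁'⟩ := exists_radial_profile (Fintype.card ι)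
  set H : ℝ → ℝ := fun s => 4 * s * deriv a s + 2 * Fintype.card ι * a s with hH
  have hHc : ContDiff ℝ ∞ H :=
    ((contDiff_const.mul contDiff_id).mul (contDiff_infty_iff_deriv.1 ha).2).add
      (contDiff_const.mul ha)
  set R : ℝ := 1 + ∑ i, ‖b i‖
  have hR : 0 < R := add_pos_of_pos_of_nonneg one_pos (Finset.sum_nonneg fun i _ => norm_nonneg _)
  have hout : ∀ y, y ∉ closedBall (0 : E) R → 1 ≤ sqNorm b y := fun y hy => by
    by_contra! h
    exact hy (mem_closedBall_of_sqNorm_le_one b h.le)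
  have hc : 0 < ∫ y, H (sqNorm b y) ∂μ := by
    obtain ⟨y₁, hy₁⟩ := exists_sqNorm_eq b hs₁
    refine (hHc.continuous.comp
      (contDiff_sqNorm b).continuous).integral_pos_of_hasCompactSupport_nonneg_nonzero
      (HasCompactSupport.intro (isCompact_closedBall (0 : E) R) fun y hy => ha1 _ (hout y hy))
      (fun y => hapos _ (sqNorm_nonneg b y)) (x := y₁) ?_
    simpa [hy₁] using hs₁'
  set c := ∫ y, H (sqNorm b y) ∂μ
  obtain ⟨G, hG, hGd, -⟩ := exists_contDiff_primitive (a := fun s => c⁻¹ * a s)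
    (contDiff_const.mul ha) 0
  obtain ⟨Ψ, hΨ, hΨd, hΨi⟩ := exists_contDiff_primitive (a := fun s => c⁻¹ * H s / 2)
    ((contDiff_const.mul hHc).div_const 2) 1
  have hlap : ∀ y, lapFamily b (fun y => G (sqNorm b y)) y = c⁻¹ * H (sqNorm b y) := by
    intro y
    rw [lapFamily_comp_sqNorm b (contDiff_const.mul ha) hGd,
      deriv_const_mul _ (ha.differentiable (by simp) _)]
    simp only [hH]
    ring
  refine ⟨fun y => G (sqNorm b y), fun y => Ψ (sqNorm b y), R, hR,
    hG.comp (contDiff_sqNorm b), hΨ.comp (contDiff_sqNorm b), fun y hy => ?_, fun y hy => ?_,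
    fun i y => ?_, ?_⟩
  · rw [hΨi]
    refine intervalIntegral.integral_zero_ae (Eventually.of_forall fun s hs => ?_)
    rw [uIoc_of_le (hout y hy)] at hs
    simp [hH, ha1 s hs.1.le]
  · rw [hlap]
    simp [hH, ha1 _ (hout y hy)]
  · rw [fderiv_comp_sqNorm b (hΨd _), hlap]
    ring
  · simp_rw [hlap]
    rw [integral_const_mul]
    exact inv_mul_cancel₀ hc.ne'

end Kernel

section SlideIntegral

variable {Y E W : Type} [NormedAddCommGroup Y] [NormedSpace ℝ Y]
  [NormedAddCommGroup E] [NormedSpace ℝ E] [NormedAddCommGroup W] [NormedSpace ℝ W]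

/-- The average of `u` along the translates of the image of a linear map `L`, weighted by `K`. -/
def slideInt [MeasurableSpace Y] (μ : Measure Y) (K : Y → ℝ) (L : Y →L[ℝ] E) (u : E → W)
    (x : E) : W :=
  ∫ y, K y • u (x + L y) ∂μ

/-- A support condition making `slideInt μ K L u` an integral over a compact set. -/
def SlideSupport (K : Y → ℝ) (L : Y →L[ℝ] E) (u : E → W) : Prop :=
  HasCompactSupport K ∨ (HasCompactSupport u ∧ Function.Injective L)

variable {K : Y → ℝ} {L : Y →L[ℝ] E} {u : E → W}

lemma SlideSupport.fderiv_right (h : SlideSupport K L u) (v : E) :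
    SlideSupport K L fun z => fderiv ℝ u z v :=
  h.imp id fun h => ⟨h.1.fderiv_apply ℝ v, h.2⟩

omit [NormedSpace ℝ W] in
lemma SlideSupport.fderiv_left (h : SlideSupport K L u) (w : Y) :
    SlideSupport (fun y => fderiv ℝ K y w) L u :=
  h.imp (fun h => h.fderiv_apply ℝ w) id

lemma hasFDerivAt_comp_add (hu : ContDiff ℝ 1 u) (x : E) (y : Y) (k : ℝ) :
    HasFDerivAt (fun x => k • u (x + L y)) (k • fderiv ℝ u (x + L y)) x := by
  have h := (hu.differentiable one_ne_zero (x + L y)).hasFDerivAt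
  exact (h.comp x ((hasFDerivAt_id x).add_const (L y))).const_smul k

variable [FiniteDimensional ℝ Y]

lemma SlideSupport.exists_compact (h : SlideSupport K L u) (x₀ : E) :
    ∃ C : Set Y, IsCompact C ∧ ∀ᶠ x in 𝓝 x₀, ∀ y, y ∉ C → K y • u (x + L y) = 0 := by
  rcases h with h | ⟨h, hL⟩
  · exact ⟨tsupport K, h, Eventually.of_forall fun x y hy => by
      rw [image_eq_zero_of_notMem_tsupport hy, zero_smul]⟩
  · obtain ⟨c, -, hc⟩ := (L : Y →ₗ[ℝ] E).exists_antilipschitzWith (LinearMap.ker_eq_bot.2 hL)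
    obtain ⟨B, hB⟩ := h.isBounded.subset_closedBall 0
    refine ⟨closedBall 0 (c * (B + ‖x₀‖ + 1)), isCompact_closedBall _ _, ?_⟩
    filter_upwards [ball_mem_nhds x₀ one_pos] with x hx y hy
    rw [image_eq_zero_of_notMem_tsupport (f := u), smul_zero]
    intro hmem
    refine hy ?_
    have h1 := mem_closedBall_zero_iff.1 (hB hmem)
    have h2 : ‖L y‖ ≤ B + ‖x₀‖ + 1 := by
      have e : L y = (x + L y) - x := by abel
      have h3 : ‖x‖ ≤ ‖x₀‖ + 1 := by
        have := norm_le_norm_add_norm_sub x₀ x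
        rw [mem_ball_iff_norm] at hx
        rw [norm_sub_rev] at this
        linarith
      calc ‖L y‖ = ‖(x + L y) - x‖ := by rw [← e]
        _ ≤ ‖x + L y‖ + ‖x‖ := norm_sub_le _ _
        _ ≤ _ := by linarith
    have h4 := hc.le_mul_dist y 0
    rw [map_zero, dist_zero_right, dist_zero_right] at h4
    rw [mem_closedBall_zero_iff]
    exact h4.trans (by gcongr; exact h2)

variable [MeasurableSpace Y] [BorelSpace Y] (μ : Measure Y)

lemma SlideSupport.integrable [IsFiniteMeasureOnCompacts μ] (h : SlideSupport K L u)
    (hK : Continuous K) (hu : Continuous u) (x : E) :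
    Integrable (fun y => K y • u (x + L y)) μ := by
  obtain ⟨C, hC, h0⟩ := h.exists_compact x
  refine Continuous.integrable_of_hasCompactSupport (by fun_prop) ?_
  exact HasCompactSupport.intro hC h0.self_of_nhds

variable [FiniteDimensional ℝ E]

lemma fderiv_slideInt [IsFiniteMeasureOnCompacts μ] (hK : ContDiff ℝ 1 K) (hu : ContDiff ℝ 1 u)
    (h : SlideSupport K L u) (x : E) :
    DifferentiableAt ℝ (slideInt μ K L u) x ∧ ∀ v,
      fderiv ℝ (slideInt μ K L u) x v = slideInt μ K L (fun z => fderiv ℝ u z v) x := by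
  obtain ⟨C, hC, h0⟩ := h.exists_compact x
  have hΦ : ContDiff ℝ 1 fun q : E × Y => K q.2 • u (q.1 + L q.2) :=
    (hK.comp contDiff_snd).smul (hu.comp (contDiff_fst.add (L.contDiff.comp contDiff_snd)))
  have hd := hasFDerivAt_integral_of_contDiff μ (Φ := fun x y => K y • u (x + L y)) hΦ hC h0
  refine ⟨hd.differentiableAt, fun v => ?_⟩
  have e : fderiv ℝ (slideInt μ K L u) x = _ := hd.fderiv
  rw [e]
  have e2 (y : Y) : fderiv ℝ (fun x => K y • u (x + L y)) x = K y • fderiv ℝ u (x + L y) :=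
    (hasFDerivAt_comp_add hu x y (K y)).fderiv
  simp_rw [e2]
  rw [ContinuousLinearMap.integral_apply]
  · rfl
  · have hc : Continuous (fderiv ℝ u) := hu.continuous_fderiv one_ne_zero
    have h' : SlideSupport K L (fderiv ℝ u) := h.imp id fun h => ⟨h.1.fderiv ℝ, h.2⟩
    exact h'.integrable μ hK.continuous hc x

lemma contDiff_slideInt [IsFiniteMeasureOnCompacts μ] (hK : ContDiff ℝ ∞ K)
    (hu : ContDiff ℝ ∞ u) (h : SlideSupport K L u) : ContDiff ℝ ∞ (slideInt μ K L u) := by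
  rw [contDiff_infty]
  intro n
  induction n generalizing u with
  | zero =>
    exact contDiff_zero.2 (continuous_iff_continuousAt.2 fun x =>
      (fderiv_slideInt μ (hK.of_le (by simp)) (hu.of_le (by simp)) h x).1.continuousAt)
  | succ n ih =>
    have hd := fderiv_slideInt μ (hK.of_le (by simp)) (hu.of_le (by simp)) h
    push_cast
    rw [contDiff_succ_iff_fderiv_apply]
    refine ⟨fun x => (hd x).1, by simp, fun v => ?_⟩
    rw [funext fun x => (hd x).2 v]
    exact ih (hu.fderiv_dir v) (h.fderiv_right v)

omit [FiniteDimensional ℝ E] in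
lemma slideInt_fderiv_right [μ.IsAddHaarMeasure] (hK : ContDiff ℝ 1 K) (hu : ContDiff ℝ 1 u)
    (h : SlideSupport K L u) (w : Y) (x : E) :
    slideInt μ K L (fun z => fderiv ℝ u z (L w)) x
      = - slideInt μ (fun y => fderiv ℝ K y w) L u x := by
  have hd (y : Y) : HasFDerivAt (fun y => u (x + L y)) ((fderiv ℝ u (x + L y)).comp L) y := by
    have h1 := (hu.differentiable one_ne_zero (x + L y)).hasFDerivAt
    exact h1.comp y (L.hasFDerivAt.const_add x)
  have hK' : Continuous fun y => fderiv ℝ K y w :=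
    (hK.continuous_fderiv one_ne_zero).clm_apply continuous_const
  have hu' : Continuous fun z => fderiv ℝ u z (L w) :=
    (hu.continuous_fderiv one_ne_zero).clm_apply continuous_const
  have e (y : Y) : fderiv ℝ (fun y => u (x + L y)) y w = fderiv ℝ u (x + L y) (L w) := by
    rw [(hd y).fderiv]; rfl
  have := integral_smul_fderiv_eq_neg_fderiv_smul_of_integrable (μ := μ) (f := K)
    (g := fun y => u (x + L y)) (v := w)
    ((h.fderiv_left w).integrable μ hK' hu.continuous x)
    (by simp_rw [e]; exact (h.fderiv_right (L w)).integrable μ hK.continuous hu' x)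
    (h.integrable μ hK.continuous hu.continuous x)
    (fun y _ => hK.differentiable one_ne_zero y) (fun y _ => (hd y).differentiableAt)
  simp_rw [e] at this
  exact this

variable {ι κ : Type} [Fintype ι] [Fintype κ]

omit [FiniteDimensional ℝ E] in
lemma slideInt_sum_right [IsFiniteMeasureOnCompacts μ] {g : ι → E → W}
    (hK : Continuous K) (hg : ∀ i, Continuous (g i)) (h : ∀ i, SlideSupport K L (g i)) (x : E) :
    slideInt μ K L (fun z => ∑ i, g i z) x = ∑ i, slideInt μ K L (g i) x := by
  simp only [slideInt, Finset.smul_sum]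
  exact integral_finsetSum _ fun i _ => (h i).integrable μ hK (hg i) x

lemma lapFamily_slideInt [IsFiniteMeasureOnCompacts μ] (hK : ContDiff ℝ 1 K)
    (hu : ContDiff ℝ ∞ u) (h : SlideSupport K L u) (e : ι → E) (x : E) :
    lapFamily e (slideInt μ K L u) x = slideInt μ K L (lapFamily e u) x := by
  have e2 : lapFamily e u = fun z => ∑ i, fderiv ℝ (fun z => fderiv ℝ u z (e i)) z (e i) := rfl
  rw [e2, slideInt_sum_right μ hK.continuous
    (fun i => ((hu.fderiv_dir (e i)).fderiv_dir (e i)).continuous)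
    fun i => (h.fderiv_right (e i)).fderiv_right (e i)]
  refine Finset.sum_congr rfl fun i _ => ?_
  rw [funext fun x => (fderiv_slideInt μ hK (hu.of_le (by simp)) h x).2 (e i),
    (fderiv_slideInt μ hK ((hu.fderiv_dir (e i)).of_le (by simp)) (h.fderiv_right _) x).2]

omit [FiniteDimensional ℝ E] in
lemma slideInt_lapFamily_right [μ.IsAddHaarMeasure] (hK : ContDiff ℝ ∞ K)
    (hu : ContDiff ℝ ∞ u) (h : SlideSupport K L u) (e : ι → Y) (x : E) :
    slideInt μ K L (lapFamily (fun i => L (e i)) u) x = slideInt μ (lapFamily e K) L u x := by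
  have e2 : lapFamily (fun i => L (e i)) u
    = fun z => ∑ i, fderiv ℝ (fun z => fderiv ℝ u z (L (e i))) z (L (e i)) := rfl
  rw [e2, slideInt_sum_right μ hK.continuous
    (fun i => ((hu.fderiv_dir (L (e i))).fderiv_dir (L (e i))).continuous)
    fun i => (h.fderiv_right (L (e i))).fderiv_right (L (e i))]
  have h1 (i : ι) : slideInt μ K L
      (fun z => fderiv ℝ (fun z => fderiv ℝ u z (L (e i))) z (L (e i))) x
      = slideInt μ (fun y => fderiv ℝ (fun y => fderiv ℝ K y (e i)) y (e i)) L u x := by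
    rw [slideInt_fderiv_right μ (hK.of_le (by simp)) ((hu.fderiv_dir _).of_le (by simp))
      (h.fderiv_right _), slideInt_fderiv_right μ ((hK.fderiv_dir _).of_le (by simp))
      (hu.of_le (by simp)) (h.fderiv_left _), neg_neg]
  simp_rw [h1, slideInt, lapFamily, Finset.sum_smul]
  exact (integral_finsetSum _ fun i _ => ((h.fderiv_left _).fderiv_left _).integrable μ
    ((hK.fderiv_dir _).fderiv_dir _).continuous hu.continuous x).symm

end SlideIntegral

section MeanValue

variable {Y E W : Type} [NormedAddCommGroup Y] [NormedSpace ℝ Y] [FiniteDimensional ℝ Y]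
  [MeasurableSpace Y] [BorelSpace Y] {μ : Measure Y} [μ.IsAddHaarMeasure]
  [NormedAddCommGroup E] [NormedSpace ℝ E] [FiniteDimensional ℝ E]
  [NormedAddCommGroup W] [NormedSpace ℝ W] {ι : Type} [Fintype ι] {b : Module.Basis ι ℝ Y}
  {N ψ : Y → ℝ} {R : ℝ} {L : Y →L[ℝ] E} {u : E → W}

omit [FiniteDimensional ℝ Y] [BorelSpace Y] [FiniteDimensional ℝ E] [μ.IsAddHaarMeasure] in
lemma slideInt_congr {K : Y → ℝ} {w : E → W} {x : E} (hK : ∀ y, y ∉ closedBall (0 : Y) R → K y = 0)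
    (h : ∀ y ∈ closedBall (0 : Y) R, u (x + L y) = w (x + L y)) :
    slideInt μ K L u x = slideInt μ K L w x := by
  refine integral_congr_ae (Eventually.of_forall fun y => ?_)
  by_cases hy : y ∈ closedBall (0 : Y) R
  · simp [h y hy]
  · simp [hK y hy]

namespace IsMeanKernel

omit [BorelSpace Y] [μ.IsAddHaarMeasure] in
lemma hasCompactSupport_grad (hk : IsMeanKernel μ b N ψ R) : HasCompactSupport ψ :=
  HasCompactSupport.intro (isCompact_closedBall 0 R) hk.grad_eq_zero

omit [BorelSpace Y] [μ.IsAddHaarMeasure] in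
lemma hasCompactSupport_lap (hk : IsMeanKernel μ b N ψ R) : HasCompactSupport (lapFamily b N) :=
  HasCompactSupport.intro (isCompact_closedBall 0 R) hk.lap_eq_zero

omit [FiniteDimensional ℝ E] in
/-- A mean value property, from the vanishing of the derivatives of the averages over the
dilations of the kernel. -/
lemma slideInt_lap_eq_of_sum_eq_zero [CompleteSpace W] (hk : IsMeanKernel μ b N ψ R)
    (hu : ContDiff ℝ 1 u) {x : E}
    (h : ∀ t ∈ Ioo (0 : ℝ) 1, ∑ i, slideInt μ (fun y => fderiv ℝ ψ y (b i)) (t • L)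
      (fun z => fderiv ℝ u z (L (b i))) x = 0) :
    slideInt μ (lapFamily b N) L u x = u x := by
  have hη := hk.contDiff.lapFamily b
  have hΦ : ContDiff ℝ 1 fun q : ℝ × Y => lapFamily b N q.2 • u (x + q.1 • L q.2) :=
    ((hη.of_le (by simp)).comp contDiff_snd).smul (hu.comp (contDiff_const.add
      (contDiff_fst.smul (L.contDiff.comp contDiff_snd))))
  have hd (t : ℝ) := hasFDerivAt_integral_of_contDiff μ
    (Φ := fun (t : ℝ) y => lapFamily b N y • u (x + t • L y)) hΦ (x₀ := t)
    (isCompact_closedBall (0 : Y) R) (Eventually.of_forall fun t y hy => by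
      rw [hk.lap_eq_zero y hy, zero_smul])
  set I : ℝ → W := fun t => ∫ y, lapFamily b N y • u (x + t • L y) ∂μ with hI
  have hpt (t : ℝ) (y : Y) : HasDerivAt (fun t : ℝ => lapFamily b N y • u (x + t • L y))
      (lapFamily b N y • fderiv ℝ u (x + t • L y) (L y)) t := by
    have h1 := (hu.differentiable one_ne_zero (x + t • L y)).hasFDerivAt
    have h2 : HasDerivAt (fun t : ℝ => x + t • L y) (L y) t := by
      simpa using ((hasDerivAt_id t).smul_const (L y)).const_add x
    exact (h1.comp_hasDerivAt t h2).const_smul _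
  have hsum (t : ℝ) : HasDerivAt I (∑ i, slideInt μ (fun y => fderiv ℝ ψ y (b i)) (t • L)
      (fun z => fderiv ℝ u z (L (b i))) x) t := by
    have h1 := (hd t).hasDerivAt
    convert h1 using 1
    have hc : Continuous fun y => fderiv ℝ (fun t : ℝ => lapFamily b N y • u (x + t • L y)) t := by
      have e : (fun y => fderiv ℝ (fun t : ℝ => lapFamily b N y • u (x + t • L y)) t)
          = fun y => ContinuousLinearMap.toSpanSingleton ℝ
            (lapFamily b N y • fderiv ℝ u (x + t • L y) (L y)) :=
        funext fun y => (hpt t y).hasFDerivAt.fderiv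
      rw [e]
      have hc1 := hu.continuous_fderiv one_ne_zero
      have hc2 := hη.continuous
      have : Continuous fun y => lapFamily b N y • fderiv ℝ u (x + t • L y) (L y) := by fun_prop
      exact (ContinuousLinearMap.toSpanSingletonCLE (𝕜 := ℝ) (E := W)).continuous.comp this
    rw [ContinuousLinearMap.integral_apply (hc.integrable_of_hasCompactSupport
      (HasCompactSupport.intro (isCompact_closedBall 0 R) fun y hy => by
        simp [hk.lap_eq_zero y hy]))]
    have e (y : Y) : fderiv ℝ (fun t : ℝ => lapFamily b N y • u (x + t • L y)) t 1
        = ∑ i, fderiv ℝ ψ y (b i) • fderiv ℝ u (x + (t • L) y) (L (b i)) := by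
      rw [(hpt t y).hasFDerivAt.fderiv]
      simp only [ContinuousLinearMap.toSpanSingleton_apply, one_smul, hk.fderiv_grad]
      have hy : L y = ∑ i, b.repr y i • L (b i) := by
        conv_lhs => rw [← b.sum_repr y, map_sum]
        simp only [map_smul]
      simp only [smul_apply, hy, map_sum, map_smul, Finset.smul_sum, smul_smul]
      exact Finset.sum_congr rfl fun i _ => by rw [mul_comm]
    simp_rw [e]
    rw [integral_finsetSum]
    · rfl
    · intro i _
      exact SlideSupport.integrable μ (Or.inl (hk.hasCompactSupport_grad.fderiv_apply ℝ (b i)))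
        (hk.contDiff_grad.fderiv_dir (b i)).continuous
        ((hu.continuous_fderiv one_ne_zero).clm_apply continuous_const) x
  have h01 : ∀ t ∈ Ico (0 : ℝ) 1, ∑ i, slideInt μ (fun y => fderiv ℝ ψ y (b i)) (t • L)
      (fun z => fderiv ℝ u z (L (b i))) x = 0 := by
    rintro t ⟨ht0, ht1⟩
    rcases ht0.eq_or_lt with rfl | ht0
    · refine Finset.sum_eq_zero fun i _ => ?_
      have h1 := slideInt_fderiv_right μ (K := ψ) (L := L)
        (u := fun _ : E => fderiv ℝ u x (L (b i))) (hk.contDiff_grad.of_le (by simp))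
        contDiff_const (Or.inl hk.hasCompactSupport_grad) (b i) x
      simp only [slideInt, fderiv_fun_const, Pi.zero_apply, zero_apply,
        smul_zero, integral_zero, zero_eq_neg] at h1
      simpa [slideInt] using h1
    · exact h t ⟨ht0, ht1⟩
  have hI01 := constant_of_has_deriv_right_zero (f := I) (a := 0) (b := 1)
    (fun t _ => (hsum t).continuousAt.continuousWithinAt)
    (fun t ht => by simpa [h01 t ht] using (hsum t).hasDerivWithinAt) 1 (by simp)
  simp only [hI, one_smul, zero_smul, add_zero] at hI01
  rw [slideInt, hI01, integral_smul_const, hk.integral_lap, one_smul]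

/-- The mean value property of harmonic functions. -/
lemma slideInt_lap_eq [CompleteSpace W] (hk : IsMeanKernel μ b N ψ R) {U : Set E} (hU : IsOpen U)
    (hu : IsHarmonicFamily (fun i => L (b i)) u U) {x : E}
    (hx : ∀ t ∈ Icc (0 : ℝ) 1, ∀ y ∈ closedBall (0 : Y) R, x + t • L y ∈ U) :
    slideInt μ (lapFamily b N) L u x = u x := by
  set C : Set E := (fun q : ℝ × Y => x + q.1 • L q.2) '' (Icc 0 1 ×ˢ closedBall 0 R) with hC
  have hCc : IsCompact C := (isCompact_Icc.prod (isCompact_closedBall 0 R)).image (by fun_prop)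
  have hCU : C ⊆ U := by
    rintro _ ⟨⟨t, y⟩, ⟨ht, hy⟩, rfl⟩
    exact hx t ht y hy
  obtain ⟨w, hw, -, -, V, hV, hCV, hVU, hwu⟩ := exists_contDiff_extension (k := ⊤) hU hCc hCU
    (fun z hz => (hu.1 z hz).contDiffWithinAt)
  have hwu' : ∀ z ∈ V, w =ᶠ[𝓝 z] u := fun z hz => by
    filter_upwards [hV.mem_nhds hz] with y hy using hwu hy
  have hwV := (hu.mono hVU).congr hwu'
  have hmem : ∀ t ∈ Icc (0 : ℝ) 1, ∀ y ∈ closedBall (0 : Y) R, x + t • L y ∈ V :=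
    fun t ht y hy => hCV ⟨(t, y), ⟨ht, hy⟩, rfl⟩
  have h0 : x ∈ V := by
    simpa using hmem 0 (by simp) 0 (mem_closedBall_self hk.pos.le)
  rw [← hwu h0, ← slideInt_congr (μ := μ) (L := L) (x := x) (u := w) (w := u) hk.lap_eq_zero
    (fun y hy => hwu (by simpa using hmem 1 (by simp) y hy))]
  refine hk.slideInt_lap_eq_of_sum_eq_zero (hw.of_le (by simp)) fun t ht => ?_
  have hs (g : E → W) : SlideSupport ψ (t • L) g := Or.inl hk.hasCompactSupport_grad
  have h1 (i : ι) : slideInt μ (fun y => fderiv ℝ ψ y (b i)) (t • L)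
      (fun z => fderiv ℝ w z (L (b i))) x
      = - t • slideInt μ ψ (t • L) (fun z => fderiv ℝ (fun z => fderiv ℝ w z (L (b i))) z
        (L (b i))) x := by
    have := slideInt_fderiv_right μ (hk.contDiff_grad.of_le (by simp))
      ((hw.fderiv_dir (L (b i))).of_le (by simp)) (hs _) (b i) x
    rw [← neg_eq_iff_eq_neg] at this
    rw [← this]
    simp only [slideInt, smul_apply, map_smul, neg_smul]
    rw [← integral_smul]
    simp only [smul_comm t]
  simp_rw [h1]
  rw [← Finset.smul_sum, ← slideInt_sum_right μ hk.contDiff_grad.continuous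
    (fun i => ((hw.fderiv_dir _).fderiv_dir _).continuous) (fun i => hs _)]
  have h2 := slideInt_congr (μ := μ) (K := ψ) (L := t • L) (x := x)
    (u := lapFamily (fun i => L (b i)) w) (w := fun _ => 0) hk.grad_eq_zero
    (fun y hy => hwV.2 _ (by simpa using hmem t (Ioo_subset_Icc_self ht) y hy))
  have h3 : slideInt μ ψ (t • L) (lapFamily (fun i => L (b i)) w) x = 0 := by
    rw [h2]; simp [slideInt]
  exact (congrArg _ h3).trans (smul_zero _)

end IsMeanKernel

end MeanValue

section UniqueContinuation

variable {E W : Type} [NormedAddCommGroup E] [NormedSpace ℝ E] [NormedAddCommGroup W]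
  [NormedSpace ℝ W] {ι : Type} [Fintype ι]

lemma lapFamily_smul_family (e : ι → E) (r : ℝ) (u : E → W) {x : E}
    (hu : ContDiffAt ℝ ∞ u x) :
    lapFamily (fun i => r • e i) u x = r ^ 2 • lapFamily e u x := by
  simp only [lapFamily, map_smul, Finset.smul_sum]
  refine Finset.sum_congr rfl fun i _ => ?_
  rw [fderiv_fun_const_smul ((hu.fderiv_dir (e i)).differentiableAt (by simp))]
  simp [smul_smul, sq]

lemma IsHarmonicFamily.smul_family {e : ι → E} {u : E → W} {U : Set E}
    (hu : IsHarmonicFamily e u U) (r : ℝ) : IsHarmonicFamily (fun i => r • e i) u U :=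
  ⟨hu.1, fun x hx => by rw [lapFamily_smul_family e r u (hu.1 x hx), hu.2 x hx, smul_zero]⟩

lemma norm_le_pow_div_factorial {γ : ℕ → ℝ → W} {k : ℕ} {B : ℝ}
    (hd : ∀ j, ∀ t ∈ Icc (0 : ℝ) 1, HasDerivAt (γ j) (γ (j + 1) t) t) (h0 : ∀ j, γ j 0 = 0)
    (hB : ∀ t ∈ Icc (0 : ℝ) 1, ‖γ k t‖ ≤ B) :
    ‖γ 0 1‖ ≤ B / k.factorial := by
  have key : ∀ i j : ℕ, i + j = k → ∀ t ∈ Icc (0 : ℝ) 1, ‖γ j t‖ ≤ B * t ^ i / i.factorial := by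
    intro i
    induction i with
    | zero =>
      intro j hj t ht
      obtain rfl : j = k := by omega
      simpa using hB t ht
    | succ i ih =>
      intro j hj
      refine image_norm_le_of_norm_deriv_right_le_deriv_boundary
        (B' := fun t => B * t ^ i / i.factorial)
        (fun t ht => (hd j t ht).continuousAt.continuousWithinAt)
        (fun t ht => (hd j t (Ico_subset_Icc_self ht)).hasDerivWithinAt)
        (by simp [h0]) ?_ fun t ht => ih (j + 1) (by omega) t (Ico_subset_Icc_self ht)
      intro t
      have h1 := ((hasDerivAt_pow (i + 1) t).const_mul B).div_const ((i + 1).factorial : ℝ)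
      refine h1.congr_deriv ?_
      rw [Nat.factorial_succ]
      have : (i.factorial : ℝ) ≠ 0 := by positivity
      push_cast
      field_simp
  simpa using key k 0 (by simp) 1 (by simp)

variable [FiniteDimensional ℝ E] [MeasurableSpace E] [BorelSpace E] {μ : Measure E}
  [μ.IsAddHaarMeasure] {b : Module.Basis ι ℝ E} {N ψ : E → ℝ} {R : ℝ} {u : E → W} {U : Set E}

lemma IsMeanKernel.slideInt_lap_eq_of_closedBall [CompleteSpace W] (hk : IsMeanKernel μ b N ψ R)
    (hU : IsOpen U) (hu : IsHarmonicFamily b u U) {x : E} {r : ℝ} (hr : 0 < r)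
    (hx : closedBall x (r * R) ⊆ U) :
    slideInt μ (lapFamily b N) (r • ContinuousLinearMap.id ℝ E) u x = u x := by
  refine hk.slideInt_lap_eq hU (by simpa using hu.smul_family r) fun t ht y hy => hx ?_
  rw [mem_closedBall_iff_norm]
  rw [mem_closedBall_zero_iff] at hy
  have h1 : ‖t‖ ≤ 1 := by rw [Real.norm_eq_abs, abs_of_nonneg ht.1]; exact ht.2
  simp only [smul_apply, ContinuousLinearMap.id_apply, add_sub_cancel_left, norm_smul]
  calc ‖t‖ * (‖r‖ * ‖y‖) ≤ 1 * (r * R) := by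
        rw [Real.norm_of_nonneg hr.le]; gcongr
    _ = r * R := one_mul _

/-- Interior estimate for the first derivatives of a harmonic function. -/
lemma IsMeanKernel.norm_fderiv_le [CompleteSpace W] (hk : IsMeanKernel μ b N ψ R)
    (hU : IsOpen U) (hu : IsHarmonicFamily b u U) {x : E} {r M : ℝ} (hr : 0 < r)
    (hx : closedBall x (r * R) ⊆ U) (hM : ∀ z ∈ closedBall x (r * R), ‖u z‖ ≤ M) (v : E) :
    ‖fderiv ℝ u x v‖ ≤ ((∫ y, ‖fderiv ℝ (lapFamily b N) y‖ ∂μ) * ‖v‖ / r) * M := by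
  have hη := hk.contDiff.lapFamily b
  obtain ⟨w, hw, -, -, V, hV, hCV, hVU, hwu⟩ := exists_contDiff_extension (k := ⊤) hU
    (isCompact_closedBall x (r * R)) hx (fun z hz => (hu.1 z hz).contDiffWithinAt)
  have hwu' : ∀ z ∈ V, w =ᶠ[𝓝 z] u := fun z hz => by
    filter_upwards [hV.mem_nhds hz] with y hy using hwu hy
  have hwV := (hu.mono hVU).congr hwu'
  have hxV : x ∈ V := hCV (mem_closedBall_self (mul_nonneg hr.le hk.pos.le))
  set L := r • ContinuousLinearMap.id ℝ E with hL
  have h1 := hk.slideInt_lap_eq_of_closedBall hV (hwV.fderiv_dir hV (L v)) hr hCV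
  rw [slideInt_fderiv_right μ (hη.of_le (by simp)) (hw.of_le (by simp))
    (Or.inl hk.hasCompactSupport_lap), (hwu' x hxV).fderiv_eq] at h1
  have h2 : fderiv ℝ u x (L v) = r • fderiv ℝ u x v := by simp [hL]
  have hout : ∀ y, y ∉ closedBall (0 : E) R → fderiv ℝ (lapFamily b N) y = 0 := fun y hy => by
    have : lapFamily b N =ᶠ[𝓝 y] fun _ => 0 := by
      filter_upwards [isClosed_closedBall.isOpen_compl.mem_nhds hy] with z hz
        using hk.lap_eq_zero z hz
    rw [this.fderiv_eq]; simp
  have h_int : Integrable (fun y => ‖fderiv ℝ (lapFamily b N) y‖) μ :=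
    (Continuous.integrable_of_hasCompactSupport (hη.continuous_fderiv (by simp))
      (HasCompactSupport.intro (isCompact_closedBall 0 R) hout)).norm
  have h3 : ‖slideInt μ (fun y => fderiv ℝ (lapFamily b N) y v) L w x‖
      ≤ ∫ y, ‖fderiv ℝ (lapFamily b N) y‖ * ‖v‖ * M ∂μ := by
    refine norm_integral_le_of_norm_le ((h_int.mul_const _).mul_const _)
      (Eventually.of_forall fun y => ?_)
    by_cases hy : y ∈ closedBall (0 : E) R
    · have hmem : x + L y ∈ closedBall x (r * R) := by
        rw [mem_closedBall_zero_iff] at hy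
        rw [mem_closedBall_iff_norm]
        simp only [hL, smul_apply, ContinuousLinearMap.id_apply, add_sub_cancel_left, norm_smul,
          Real.norm_of_nonneg hr.le]
        gcongr
      rw [norm_smul, hwu (hCV hmem)]
      gcongr
      · exact ContinuousLinearMap.le_opNorm _ _
      · exact hM _ hmem
    · simp [hout y hy]
  rw [integral_mul_const, integral_mul_const, ← norm_neg, h1, h2, norm_smul,
    Real.norm_of_nonneg hr.le] at h3
  rw [div_mul_eq_mul_div, le_div_iff₀ hr, mul_comm]
  exact h3

/-- Iterated directional derivatives. -/
def iterDir (v : E) (u : E → W) : ℕ → E → W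
  | 0 => u
  | j + 1 => fun x => fderiv ℝ (iterDir v u j) x v

omit [FiniteDimensional ℝ E] [MeasurableSpace E] [BorelSpace E] in
lemma IsHarmonicFamily.isHarmonicFamily_iterDir {e : ι → E} (hU : IsOpen U)
    (hu : IsHarmonicFamily e u U) (v : E) :
    ∀ j, IsHarmonicFamily e (iterDir v u j) U
  | 0 => hu
  | j + 1 => (hu.isHarmonicFamily_iterDir hU v j).fderiv_dir hU v

omit [FiniteDimensional ℝ E] [MeasurableSpace E] [BorelSpace E] in
lemma iterDir_eventuallyEq_zero {q : E} (h : u =ᶠ[𝓝 q] fun _ => 0) (v : E) :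
    ∀ j, iterDir v u j =ᶠ[𝓝 q] fun _ => 0
  | 0 => h
  | j + 1 => by
    have := (iterDir_eventuallyEq_zero h v j).fderiv_dir v
    simpa [iterDir] using this

lemma IsMeanKernel.norm_iterDir_le [CompleteSpace W] (hk : IsMeanKernel μ b N ψ R)
    (hU : IsOpen U) (hu : IsHarmonicFamily b u U) {p : E} {ρ M : ℝ} (hρ : 0 < ρ)
    (hp : closedBall p (2 * ρ) ⊆ U) (hM : ∀ z ∈ closedBall p (2 * ρ), ‖u z‖ ≤ M) (v : E)
    {k : ℕ} (hk0 : 0 < k) (j : ℕ) :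
    ∀ x ∈ closedBall p (2 * ρ - j * (ρ / k)), ‖iterDir v u j x‖
      ≤ ((∫ y, ‖fderiv ℝ (lapFamily b N) y‖ ∂μ) * ‖v‖ * R * k / ρ) ^ j * M := by
  have hR := hk.pos
  have hk0' : (0 : ℝ) < k := by exact_mod_cast hk0
  induction j with
  | zero => intro x hx; simpa [iterDir] using hM x (by simpa using hx)
  | succ j ih =>
    intro x hx
    have hr : 0 < ρ / (k * R) := by positivity
    have hrR : ρ / (k * R) * R = ρ / k := by field_simp
    have hsub : closedBall x (ρ / (k * R) * R) ⊆ closedBall p (2 * ρ - j * (ρ / k)) := by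
      rw [hrR]
      refine closedBall_subset_closedBall' ?_
      rw [mem_closedBall] at hx
      push_cast at hx
      linarith
    have hsub2 : closedBall p (2 * ρ - j * (ρ / k)) ⊆ U :=
      (closedBall_subset_closedBall (by
        have : 0 ≤ j * (ρ / k) := by positivity
        linarith)).trans hp
    have h1 := hk.norm_fderiv_le hU (hu.isHarmonicFamily_iterDir hU v j) hr (hsub.trans hsub2)
      (fun z hz => ih z (hsub hz)) v
    refine h1.trans_eq ?_
    rw [pow_succ]
    field_simp

/-- Unique continuation for harmonic functions. -/
lemma IsHarmonicFamily.eqOn_zero [CompleteSpace W] [Nonempty ι] (b : Module.Basis ι ℝ E)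
    (hU : IsOpen U) (hUc : IsPreconnected U) (hu : IsHarmonicFamily b u U) {Y : Set E}
    (hY : IsOpen Y) (hYne : Y.Nonempty) (hYU : Y ⊆ U) (h0 : ∀ x ∈ Y, u x = 0) :
    ∀ x ∈ U, u x = 0 := by
  obtain ⟨N, ψ, R, hk⟩ := exists_isMeanKernel (Measure.addHaar : Measure E) b
  set A := ∫ y, ‖fderiv ℝ (lapFamily b N) y‖ ∂(Measure.addHaar : Measure E)
  have hA : 0 ≤ A := integral_nonneg fun y => norm_nonneg _
  have hR := hk.pos
  set Z : Set E := interior {x | u x = 0}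
  have hYZ : Y ⊆ Z := interior_maximal h0 hY
  suffices h : U ⊆ Z from fun x hx => interior_subset (s := {x | u x = 0}) (h hx)
  refine hUc.subset_of_closure_inter_subset isOpen_interior
    (hYne.mono fun x hx => ⟨hYU hx, hYZ hx⟩) ?_
  rintro p ⟨hpZ, hpU⟩
  obtain ⟨ρ', hρ', hball⟩ := Metric.isOpen_iff.1 hU p hpU
  set ρ := ρ' / 4
  have hρ : 0 < ρ := by positivity
  have hρU : closedBall p (2 * ρ) ⊆ U :=
    (closedBall_subset_ball (by simp only [ρ]; linarith)).trans hball
  obtain ⟨M, hM⟩ := (isCompact_closedBall p (2 * ρ)).exists_bound_of_continuousOn (f := u)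
    fun x hx => (hu.1 x (hρU hx)).continuousAt.continuousWithinAt
  set c := 4 * (A + 1) * R * Real.exp 1
  have hc : 0 < c := by positivity
  set s := min ρ (ρ / c)
  have hs : 0 < s := by positivity
  have hzero : ∀ x ∈ ball p s, u x = 0 := by
    intro x hx
    obtain ⟨q, hqp, hqZ⟩ := mem_closure_iff.1 hpZ (ball p s) isOpen_ball (mem_ball_self hs)
    set v := x - q
    have hv : ‖v‖ ≤ 2 * (ρ / c) := by
      have h1 := dist_triangle_right x q p
      rw [dist_eq_norm] at h1
      have h2 := mem_ball.1 hx
      have h3 := mem_ball.1 hqp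
      have h4 : s ≤ ρ / c := min_le_right _ _
      linarith
    have hseg : ∀ t ∈ Icc (0 : ℝ) 1, q + t • v ∈ closedBall p ρ := fun t ht =>
      ball_subset_closedBall (ball_subset_ball (min_le_left _ _)
        ((convex_ball p s).add_smul_sub_mem hqp hx ht))
    have hest : ∀ k : ℕ, 0 < k → ‖u x‖ ≤ (1 / 2) ^ k * M := by
      intro k hk0
      have hk0' : (0 : ℝ) < k := by exact_mod_cast hk0
      have h1 := norm_le_pow_div_factorial (γ := fun j t => iterDir v u j (q + t • v)) (k := k)
        (B := (A * ‖v‖ * R * k / ρ) ^ k * M) (fun j t ht => by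
          have hmem := hρU (closedBall_subset_closedBall (by linarith) (hseg t ht))
          have h2 := (((hu.isHarmonicFamily_iterDir hU v j).1 _ hmem).differentiableAt
            (by simp)).hasFDerivAt
          have h3 : HasDerivAt (fun t : ℝ => q + t • v) v t := by
            simpa using ((hasDerivAt_id t).smul_const v).const_add q
          exact h2.comp_hasDerivAt t h3) (fun j => by
          have h2 := iterDir_eventuallyEq_zero (q := q) (u := u)
            (mem_interior_iff_mem_nhds.1 hqZ) v j
          simpa using h2.self_of_nhds) (fun t ht => by
          refine hk.norm_iterDir_le hU hu hρ hρU hM v hk0 k _ ?_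
          have : 2 * ρ - k * (ρ / k) = ρ := by field_simp; ring
          rw [this]
          exact hseg t ht)
      have hM0 : 0 ≤ M := (norm_nonneg _).trans (hM p (mem_closedBall_self (by positivity)))
      have e1 : iterDir v u 0 (q + (1 : ℝ) • v) = u x := by simp [iterDir, v]
      rw [e1] at h1
      refine h1.trans ?_
      rw [mul_div_right_comm]
      refine mul_le_mul_of_nonneg_right ?_ hM0
      have hexp := Real.pow_div_factorial_le_exp (x := (k : ℝ)) hk0'.le k
      have e2 : (A * ‖v‖ * R * k / ρ) ^ k / k.factorial
          = (A * ‖v‖ * R / ρ) ^ k * ((k : ℝ) ^ k / k.factorial) := by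
        rw [← mul_div_assoc, ← mul_pow]; congr 2; ring
      rw [e2]
      calc (A * ‖v‖ * R / ρ) ^ k * ((k : ℝ) ^ k / k.factorial)
          ≤ (A * ‖v‖ * R / ρ) ^ k * Real.exp k := by gcongr
        _ = (A * ‖v‖ * R / ρ * Real.exp 1) ^ k := by
          rw [mul_pow, ← Real.exp_nat_mul, mul_one]
        _ ≤ (1 / 2) ^ k := by
          gcongr
          calc A * ‖v‖ * R / ρ * Real.exp 1
              ≤ (A + 1) * (2 * (ρ / c)) * R / ρ * Real.exp 1 := by gcongr; linarith
            _ = 1 / 2 := by simp only [c]; field_simp; norm_num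
    have hlim : Tendsto (fun k : ℕ => (1 / 2 : ℝ) ^ k * M) atTop (𝓝 0) := by
      simpa using (tendsto_pow_atTop_nhds_zero_of_lt_one (r := (1 / 2 : ℝ)) (by norm_num)
        (by norm_num)).mul_const M
    exact norm_le_zero_iff.1 (ge_of_tendsto hlim
      ((eventually_gt_atTop 0).mono fun k hk => hest k hk))
  exact mem_interior_iff_mem_nhds.2 (mem_of_superset (ball_mem_nhds p hs) hzero)

end UniqueContinuation

section Algebra

namespace HCAlg

variable (H : HCAlg 𝔸 m)

lemma conj_v {s : Fin (m + 1)} (hs : s ≠ 0) : H.conj (H.v s) = -H.v s :=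
  eq_neg_of_add_eq_zero_right (H.v_trace s hs)

lemma v_mul_v {s : Fin (m + 1)} (hs : s ≠ 0) : H.mul (H.v s) (H.v s) = -H.one := by
  have h := H.v_norm s hs
  rw [H.conj_v hs, map_neg] at h
  rw [← h, neg_neg]

lemma alt_left_add (a b c : 𝔸) :
    H.mul a (H.mul b c) + H.mul b (H.mul a c) = H.mul (H.mul a b + H.mul b a) c := by
  have h := H.alt_left (a + b) c
  simp only [map_add, LinearMap.add_apply, H.alt_left] at h
  simp only [map_add, LinearMap.add_apply]
  rw [← sub_eq_zero] at h ⊢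
  rw [← h]
  abel

lemma conj_mul_add {s t : Fin (m + 1)} (hst : s ≠ t) (c : 𝔸) :
    H.mul (H.conj (H.v t)) (H.mul (H.v s) c) + H.mul (H.conj (H.v s)) (H.mul (H.v t) c) = 0 := by
  by_cases hs : s = 0
  · subst hs
    rw [H.conj_v hst.symm, H.v_zero, H.conj_one, H.one_mul', H.one_mul']
    simp
  by_cases ht : t = 0
  · subst ht
    rw [H.conj_v hs, H.v_zero, H.conj_one, H.one_mul', H.one_mul']
    simp
  rw [H.conj_v hs, H.conj_v ht]
  have h := H.alt_left_add (H.v t) (H.v s) c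
  rw [H.v_anticomm s t hs ht hst, add_neg_cancel, map_zero, LinearMap.zero_apply] at h
  simp only [map_neg, LinearMap.neg_apply]
  rw [← neg_add, h, neg_zero]

lemma conj_mul_self (s : Fin (m + 1)) (c : 𝔸) :
    H.mul (H.conj (H.v s)) (H.mul (H.v s) c) = c := by
  by_cases hs : s = 0
  · subst hs
    rw [H.v_zero, H.conj_one, H.one_mul', H.one_mul']
  · rw [H.conj_v hs, map_neg, LinearMap.neg_apply, H.alt_left, H.v_mul_v hs, map_neg,
      LinearMap.neg_apply, neg_neg, H.one_mul']

lemma sum_diag_eq_zero {J : Fin (m + 1) → Fin (m + 1) → 𝔸} (hJ : ∀ s t, J s t = J t s)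
    (h : ∀ t, ∑ s, H.mul (H.v s) (J t s) = 0) : ∑ s, J s s = 0 := by
  set T : Fin (m + 1) → Fin (m + 1) → 𝔸 := fun t s =>
    H.mul (H.conj (H.v t)) (H.mul (H.v s) (J t s)) with hT
  have h1 : ∑ t, ∑ s, T t s = 0 := by
    refine Finset.sum_eq_zero fun t _ => ?_
    simp only [hT]
    rw [← map_sum, h, map_zero]
  have h2 : ∑ t, ∑ s, T s t = 0 := by rw [Finset.sum_comm, h1]
  have h3 : ∑ t, ∑ s, (T t s + T s t) = 0 := by
    simp_rw [Finset.sum_add_distrib, h1, h2, add_zero]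
  have h4 (t : Fin (m + 1)) : ∑ s, (T t s + T s t) = (2 : ℝ) • J t t := by
    rw [Finset.sum_eq_single t]
    · simp only [hT, H.conj_mul_self, two_smul]
    · intro s _ hst
      simp only [hT]
      rw [hJ s t]
      exact H.conj_mul_add hst (J t s)
    · simp
  simp_rw [h4] at h3
  rw [← Finset.smul_sum] at h3
  exact (smul_eq_zero.1 h3).resolve_left two_ne_zero

/-- Left multiplication by `v_s` as a continuous linear map. -/
def mulV [FiniteDimensional ℝ 𝔸] (s : Fin (m + 1)) : 𝔸 →L[ℝ] 𝔸 :=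
  LinearMap.toContinuousLinearMap (H.mul (H.v s))

lemma mulV_apply [FiniteDimensional ℝ 𝔸] (s : Fin (m + 1)) (a : 𝔸) :
    H.mulV s a = H.mul (H.v s) a := rfl

end HCAlg

end Algebra

section Monogenic

/-- The coordinate basis of `M^n`. -/
def coordBasis (n m : ℕ) : Module.Basis (Σ _ : Fin n, Fin (m + 1)) ℝ (Mn n m) :=
  Pi.basis fun _ => Pi.basisFun ℝ (Fin (m + 1))

lemma coordBasis_apply (i : Σ _ : Fin n, Fin (m + 1)) :
    coordBasis n m i = Pi.single i.1 (Pi.single i.2 1) := by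
  simp [coordBasis, Pi.basis_apply]

/-- The coordinate directions of the `j`-th block of `M^n`. -/
def blockFam (j : Fin n) (s : Fin (m + 1)) : Mn n m := Pi.single j (Pi.single s 1)

lemma lapFamily_coordBasis {W : Type} [NormedAddCommGroup W] [NormedSpace ℝ W] (u : Mn n m → W)
    (x : Mn n m) : lapFamily (coordBasis n m) u x = ∑ j, lapFamily (blockFam j) u x := by
  simp only [lapFamily, Fintype.sum_sigma, coordBasis_apply, blockFam]

lemma lapFamily_blockFam_eq_zero (H : HCAlg 𝔸 m) {f : Mn n m → 𝔸} {x : Mn n m} (j : Fin n)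
    (hf : ContDiffAt ℝ ∞ f x) (h : ∀ᶠ z in 𝓝 x, dbar H f j z = 0) :
    lapFamily (blockFam j) f x = 0 := by
  have := H.findim
  refine H.sum_diag_eq_zero
    (J := fun t s => fderiv ℝ (fun z => fderiv ℝ f z (blockFam j s)) x (blockFam j t))
    (fun s t => fderiv_dir_comm hf _ _) fun t => ?_
  have h1 : (fun z => ∑ s, H.mulV s (fderiv ℝ f z (blockFam j s))) =ᶠ[𝓝 x] fun _ => 0 := h
  have h2 (s : Fin (m + 1)) : HasFDerivAt (fun z => H.mulV s (fderiv ℝ f z (blockFam j s)))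
      ((H.mulV s).comp (fderiv ℝ (fun z => fderiv ℝ f z (blockFam j s)) x)) x :=
    (H.mulV s).hasFDerivAt.comp x
      ((hf.fderiv_dir (blockFam j s)).differentiableAt (by simp)).hasFDerivAt
  have h3 := (HasFDerivAt.fun_sum fun s (_ : s ∈ Finset.univ) => h2 s).fderiv
  rw [h1.fderiv_eq] at h3
  have h4 := DFunLike.congr_fun h3 (blockFam j t)
  simpa [HCAlg.mulV_apply] using h4.symm

lemma contDiff_slideInt_left {E W : Type} [NormedAddCommGroup E] [NormedSpace ℝ E]
    [FiniteDimensional ℝ E] [MeasurableSpace E] [BorelSpace E] (μ : Measure E)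
    [μ.IsAddHaarMeasure] [NormedAddCommGroup W] [NormedSpace ℝ W] {K : E → ℝ} {u : E → W} {r : ℝ}
    (hr : r ≠ 0) (hK : ContDiff ℝ ∞ K) (hKc : HasCompactSupport K) (hu : ContDiff ℝ 1 u) :
    ContDiff ℝ ∞ (slideInt μ K (r • ContinuousLinearMap.id ℝ E) u) := by
  rw [contDiff_infty]
  intro k
  induction k generalizing K with
  | zero =>
    exact contDiff_zero.2 (continuous_iff_continuousAt.2 fun x =>
      (fderiv_slideInt μ (hK.of_le (by simp)) hu (Or.inl hKc) x).1.continuousAt)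
  | succ k ih =>
    have hd := fderiv_slideInt μ (L := r • ContinuousLinearMap.id ℝ E)
      (hK.of_le (by simp)) hu (Or.inl hKc)
    push_cast
    rw [contDiff_succ_iff_fderiv_apply]
    refine ⟨fun x => (hd x).1, by simp, fun v => ?_⟩
    have e (x : E) : fderiv ℝ (slideInt μ K (r • ContinuousLinearMap.id ℝ E) u) x v
        = -slideInt μ (fun y => fderiv ℝ K y (r⁻¹ • v)) (r • ContinuousLinearMap.id ℝ E) u x := by
      rw [(hd x).2, ← slideInt_fderiv_right μ (hK.of_le (by simp)) hu (Or.inl hKc)]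
      simp [smul_smul, hr]
    rw [funext e]
    exact (ih (hK.fderiv_dir _) (hKc.fderiv_apply ℝ _)).neg

/-- Monogenic functions satisfy the mean value property. -/
lemma slideInt_lap_eq_of_dbar_eq_zero (H : HCAlg 𝔸 m) {μ : Measure (Mn n m)} [μ.IsAddHaarMeasure]
    {N ψ : Mn n m → ℝ} {R : ℝ} (hk : IsMeanKernel μ (coordBasis n m) N ψ R) {w : Mn n m → 𝔸}
    (hw : ContDiff ℝ 1 w) {x : Mn n m} {r : ℝ} (hr : 0 < r)
    (h : ∀ z ∈ closedBall x (r * R), ∀ j, dbar H w j z = 0) :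
    slideInt μ (lapFamily (coordBasis n m) N) (r • ContinuousLinearMap.id ℝ (Mn n m)) w x
      = w x := by
  have := H.findim
  have : CompleteSpace 𝔸 := FiniteDimensional.complete ℝ 𝔸
  set L := r • ContinuousLinearMap.id ℝ (Mn n m) with hL
  refine hk.slideInt_lap_eq_of_sum_eq_zero hw fun t ht => ?_
  have hs (v : Mn n m) (g : Mn n m → 𝔸) : SlideSupport (fun y => fderiv ℝ ψ y v) (t • L) g :=
    Or.inl (hk.hasCompactSupport_grad.fderiv_apply ℝ v)
  have hψ (v : Mn n m) : ContDiff ℝ ∞ fun y => fderiv ℝ ψ y v := hk.contDiff_grad.fderiv_dir v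
  have hwc (v : Mn n m) : Continuous fun z => fderiv ℝ w z v :=
    (hw.continuous_fderiv one_ne_zero).clm_apply continuous_const
  set Q : Mn n m → Mn n m → 𝔸 := fun a c =>
    slideInt μ (fun y => fderiv ℝ ψ y a) (t • L) (fun z => fderiv ℝ w z c) x with hQ
  have htr : t * r ≠ 0 := (mul_pos ht.1 hr).ne'
  have hQ1 (a c : Mn n m) : (t * r) • Q a c
      = - slideInt μ (fun y => fderiv ℝ (fun y => fderiv ℝ ψ y a) y c) (t • L) w x := by
    rw [← slideInt_fderiv_right μ ((hψ a).of_le (by simp)) hw (hs a w)]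
    simp only [hQ, slideInt, hL, smul_apply, ContinuousLinearMap.id_apply, map_smul, smul_smul]
    rw [← integral_smul]
    simp only [smul_smul, mul_comm]
  have hQs (a c : Mn n m) : Q a c = Q c a := by
    refine smul_right_injective 𝔸 htr ?_
    simp only [hQ1]
    congr 2
    ext1 y
    exact fderiv_dir_comm hk.contDiff_grad.contDiffAt _ _
  have hout (v : Mn n m) : ∀ y, y ∉ closedBall (0 : Mn n m) R → fderiv ℝ ψ y v = 0 := by
    intro y hy
    have : ψ =ᶠ[𝓝 y] fun _ => 0 := by
      filter_upwards [isClosed_closedBall.isOpen_compl.mem_nhds hy] with z hz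
        using hk.grad_eq_zero z hz
    rw [this.fderiv_eq]; simp
  have hQd (j : Fin n) : ∑ s, Q (blockFam j s) (blockFam j s) = 0 := by
    refine H.sum_diag_eq_zero (J := fun t s => Q (blockFam j t) (blockFam j s))
      (fun _ _ => hQs _ _) fun p => ?_
    have h1 (s : Fin (m + 1)) : H.mul (H.v s) (Q (blockFam j p) (blockFam j s))
        = slideInt μ (fun y => fderiv ℝ ψ y (blockFam j p)) (t • L)
          (fun z => H.mulV s (fderiv ℝ w z (blockFam j s))) x := by
      simp only [hQ, slideInt, ← (H.mulV s).map_smul]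
      exact ((H.mulV s).integral_comp_comm ((hs _ _).integrable μ (hψ _).continuous (hwc _) x)).symm
    simp_rw [h1]
    rw [← slideInt_sum_right μ (g := fun s z => H.mulV s (fderiv ℝ w z (blockFam j s)))
      (hψ _).continuous (fun s => (H.mulV s).continuous.comp (hwc _))
      fun s => hs _ _]
    refine (slideInt_congr (μ := μ) (w := fun _ => (0 : 𝔸)) (hout _) fun y hy => ?_).trans
      (by simp [slideInt])
    refine h _ ?_ j
    rw [mem_closedBall_zero_iff] at hy
    rw [mem_closedBall_iff_norm]
    simp only [hL, smul_apply, ContinuousLinearMap.id_apply, add_sub_cancel_left, norm_smul,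
      Real.norm_of_nonneg hr.le, Real.norm_of_nonneg ht.1.le]
    calc t * (r * ‖y‖) ≤ 1 * (r * R) := by
          gcongr
          exact ht.2.le
      _ = r * R := one_mul _
  have h2 : ∑ i, Q (coordBasis n m i) (coordBasis n m i) = 0 := by
    rw [Fintype.sum_sigma]
    refine Finset.sum_eq_zero fun j _ => ?_
    simp only [coordBasis_apply]
    exact hQd j
  have h3 (i) : slideInt μ (fun y => fderiv ℝ ψ y (coordBasis n m i)) (t • L)
      (fun z => fderiv ℝ w z (L (coordBasis n m i))) x
      = r • Q (coordBasis n m i) (coordBasis n m i) := by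
    simp only [hQ, slideInt, hL, smul_apply, ContinuousLinearMap.id_apply, map_smul]
    rw [← integral_smul]
    simp only [smul_smul, mul_comm]
  simp_rw [h3]
  rw [← Finset.smul_sum, h2, smul_zero]

lemma contDiffAt_of_dbar_eq_zero (H : HCAlg 𝔸 m) (hn : 0 < n) {U : Set (Mn n m)} (hU : IsOpen U)
    {f : Mn n m → 𝔸} (hf : ContDiffOn ℝ 1 f U) (h : ∀ x ∈ U, ∀ j, dbar H f j x = 0)
    {p : Mn n m} (hp : p ∈ U) : ContDiffAt ℝ ∞ f p := by
  have : Nonempty (Σ _ : Fin n, Fin (m + 1)) := ⟨⟨⟨0, hn⟩, 0⟩⟩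
  obtain ⟨N, ψ, R, hk⟩ := exists_isMeanKernel (Measure.addHaar : Measure (Mn n m)) (coordBasis n m)
  have hR := hk.pos
  obtain ⟨ρ, hρ, hball⟩ := Metric.isOpen_iff.1 hU p hp
  set r := ρ / (4 * R) with hr
  have hr0 : 0 < r := by positivity
  have hrR : r * R = ρ / 4 := by rw [hr]; field_simp
  have hC : closedBall p (ρ / 2) ⊆ U := (closedBall_subset_ball (by linarith)).trans hball
  obtain ⟨w, hw, -, -, V, hV, hCV, hVU, hwf⟩ := exists_contDiff_extension (k := 1) hU
    (isCompact_closedBall p (ρ / 2)) hC hf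
  have hwf' : ∀ z ∈ V, w =ᶠ[𝓝 z] f := fun z hz => by
    filter_upwards [hV.mem_nhds hz] with y hy using hwf hy
  have hwd : ∀ z ∈ V, ∀ j, dbar H w j z = 0 := fun z hz j => by
    have := h z (hVU hz) j
    simpa only [dbar, pd, (hwf' z hz).fderiv_eq] using this
  have key : f =ᶠ[𝓝 p] slideInt Measure.addHaar (lapFamily (coordBasis n m) N)
      (r • ContinuousLinearMap.id ℝ (Mn n m)) w := by
    filter_upwards [ball_mem_nhds p (show 0 < ρ / 4 by positivity)] with z hz
    have hzC : closedBall z (r * R) ⊆ closedBall p (ρ / 2) :=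
      closedBall_subset_closedBall' (by rw [hrR]; rw [mem_ball] at hz; linarith)
    rw [slideInt_lap_eq_of_dbar_eq_zero H hk hw hr0 fun y hy j => hwd y (hCV (hzC hy)) j]
    exact (hwf (hCV (hzC (mem_closedBall_self (by positivity))))).symm
  exact (contDiff_slideInt_left _ hr0.ne' (hk.contDiff.lapFamily _) hk.hasCompactSupport_lap
    hw).contDiffAt.congr_of_eventuallyEq key

lemma isHarmonicFamily_of_dbar_eq_zero (H : HCAlg 𝔸 m) (hn : 0 < n) {U : Set (Mn n m)}
    (hU : IsOpen U) {f : Mn n m → 𝔸} (hf : ContDiffOn ℝ 1 f U)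
    (h : ∀ x ∈ U, ∀ j, dbar H f j x = 0) (j : Fin n) : IsHarmonicFamily (blockFam j) f U :=
  ⟨fun _ hx => contDiffAt_of_dbar_eq_zero H hn hU hf h hx, fun x hx =>
    lapFamily_blockFam_eq_zero H j (contDiffAt_of_dbar_eq_zero H hn hU hf h hx)
      (by filter_upwards [hU.mem_nhds hx] with z hz using h z hz j)⟩

end Monogenic

section Hartogs

lemma lapFamily_sub {ι E W : Type} [Fintype ι] [NormedAddCommGroup E] [NormedSpace ℝ E]
    [NormedAddCommGroup W] [NormedSpace ℝ W] {u w : E → W} (hu : ContDiff ℝ ∞ u)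
    (hw : ContDiff ℝ ∞ w) (e : ι → E) (x : E) :
    lapFamily e (fun x => u x - w x) x = lapFamily e u x - lapFamily e w x := by
  have hs {f g : E → W} (hf : ContDiff ℝ ∞ f) (hg : ContDiff ℝ ∞ g) (z v : E) :
      fderiv ℝ (fun x => f x - g x) z v = fderiv ℝ f z v - fderiv ℝ g z v := by
    rw [fderiv_fun_sub (hf.differentiable (by simp) z) (hg.differentiable (by simp) z)]
    simp
  simp only [lapFamily, hs hu hw, hs (hu.fderiv_dir _) (hw.fderiv_dir _),
    Finset.sum_sub_distrib]

lemma isCompact_infDist_le {E : Type} [NormedAddCommGroup E] [ProperSpace E] {K : Set E}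
    (hK : IsCompact K) (hne : K.Nonempty) (c : ℝ) : IsCompact {x | infDist x K ≤ c} := by
  refine (hK.cthickening (r := c + 1)).of_isClosed_subset
    (isClosed_le (continuous_infDist_pt K) continuous_const) fun x hx => ?_
  refine thickening_subset_cthickening _ _ ((mem_thickening_iff_infDist_lt hne).2 ?_)
  exact lt_of_le_of_lt hx (by linarith)

/-- The inclusion of the `j`-th block, scaled by `r`. -/
def blockIncl (m : ℕ) (j : Fin n) (r : ℝ) : (Fin (m + 1) → ℝ) →L[ℝ] Mn n m :=
  r • ContinuousLinearMap.single ℝ (fun _ : Fin n => Fin (m + 1) → ℝ) j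

lemma blockIncl_apply (j : Fin n) (r : ℝ) (y : Fin (m + 1) → ℝ) :
    blockIncl m j r y = r • Pi.single j y := by
  simp [blockIncl]

lemma blockIncl_basisFun (j : Fin n) (r : ℝ) (s : Fin (m + 1)) :
    blockIncl m j r (Pi.basisFun ℝ (Fin (m + 1)) s) = r • blockFam j s := by
  rw [blockIncl_apply, Pi.basisFun_apply, blockFam]

lemma norm_blockIncl (j : Fin n) {r : ℝ} (hr : 0 ≤ r) (y : Fin (m + 1) → ℝ) :
    ‖blockIncl m j r y‖ = r * ‖y‖ := by
  rw [blockIncl_apply, norm_smul, Pi.norm_single, Real.norm_of_nonneg hr]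

lemma blockIncl_injective (j : Fin n) {r : ℝ} (hr : 0 < r) :
    Function.Injective (blockIncl m j r) := by
  rw [injective_iff_map_eq_zero]
  intro y hy
  have := norm_blockIncl (m := m) j hr.le y
  rw [hy, norm_zero] at this
  exact norm_eq_zero.1 ((mul_eq_zero.1 this.symm).resolve_left hr.ne')

lemma blockIncl_apply_of_ne {i j : Fin n} (hij : i ≠ j) (r : ℝ) (y : Fin (m + 1) → ℝ) :
    blockIncl m j r y i = 0 := by
  simp [blockIncl_apply, hij]

/-- A function harmonic in every block of variables outside a compact set agrees, on a nonempty
open set, with a function harmonic on the whole domain. -/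
lemma exists_isHarmonicFamily_extension [CompleteSpace 𝔸] (hn : 1 < n) {Ω K : Set (Mn n m)}
    (hΩ : IsOpen Ω) (hK : IsCompact K) (hKΩ : K ⊆ Ω) (hne : K.Nonempty) {f : Mn n m → 𝔸}
    (hf : ∀ j, IsHarmonicFamily (blockFam j) f (Ω \ K)) :
    ∃ F : Mn n m → 𝔸, IsHarmonicFamily (coordBasis n m) F Ω ∧
      ∃ Y : Set (Mn n m), IsOpen Y ∧ Y.Nonempty ∧ Y ⊆ Ω \ K ∧ ∀ x ∈ Y, F x = f x := by
  have hU : IsOpen (Ω \ K) := hΩ.sdiff hK.isClosed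
  set j₀ : Fin n := ⟨0, by omega⟩ with hj₀
  set j₁ : Fin n := ⟨1, hn⟩ with hj₁
  have hj : j₁ ≠ j₀ := by simp [hj₀, hj₁]
  have hfc : IsHarmonicFamily (coordBasis n m) f (Ω \ K) :=
    ⟨(hf j₀).1, fun x hx => by
      rw [lapFamily_coordBasis]
      exact Finset.sum_eq_zero fun j _ => (hf j).2 x hx⟩
  set D : Mn n m → ℝ := fun x => infDist x K with hD
  have hDc : Continuous D := continuous_infDist_pt K
  have hDl (x z : Mn n m) : |D (x + z) - D x| ≤ ‖z‖ := by
    have h1 := infDist_le_infDist_add_dist (x := x + z) (y := x) (s := K)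
    have h2 := infDist_le_infDist_add_dist (x := x) (y := x + z) (s := K)
    rw [dist_self_add_left] at h1
    rw [dist_self_add_right] at h2
    exact abs_le.2 ⟨by simp only [hD]; linarith, by simp only [hD]; linarith⟩
  have hDK {x : Mn n m} (hx : 0 < D x) : x ∉ K := fun h => by
    simp [hD, infDist_zero_of_mem h] at hx
  obtain ⟨ε, hε, hεΩ⟩ := hK.exists_thickening_subset_open hΩ hKΩ
  set δ := ε / 7 with hδ
  have hδ0 : 0 < δ := by positivity
  have hDΩ {x : Mn n m} (hx : D x < 7 * δ) : x ∈ Ω :=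
    hεΩ ((mem_thickening_iff_infDist_lt hne).2 (by rw [hδ] at hx; linarith))
  have hlt (c : ℝ) : IsOpen {x | D x < c} := isOpen_lt hDc continuous_const
  have hgt (c : ℝ) : IsOpen {x | c < D x} := isOpen_lt continuous_const hDc
  -- a smooth function agreeing with `f` on an annulus around `K`
  obtain ⟨u, hu, huc, -, V, hV, hCV, -, huf⟩ :=
    exists_contDiff_extension (k := ⊤) (f := f) (C := {x | D x ≤ 6 * δ} ∩ {x | 2 * δ ≤ D x}) hU
      ((isCompact_infDist_le hK hne _).inter_right (isClosed_le continuous_const hDc))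
      (fun x hx => ⟨hDΩ (lt_of_le_of_lt hx.1 (by linarith)),
        hDK (lt_of_lt_of_le (by linarith) hx.2)⟩)
      (fun x hx => ((hf j₀).1 x hx).contDiffWithinAt)
  have huf' {x : Mn n m} (h2 : 2 * δ ≤ D x) (h6 : D x ≤ 6 * δ) : u =ᶠ[𝓝 x] f := by
    filter_upwards [hV.mem_nhds (hCV ⟨h6, h2⟩)] with y hy using huf hy
  have hmem {x : Mn n m} (h2 : 2 * δ ≤ D x) (h6 : D x ≤ 6 * δ) : x ∈ Ω \ K :=
    ⟨hDΩ (by linarith), hDK (by linarith)⟩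
  -- a cutoff function
  obtain ⟨κ, hκ, -, hκs, V', hV', hCV', -, hκ1⟩ :=
    exists_contDiff_extension (k := ⊤) (f := fun _ : Mn n m => (1 : ℝ)) (hlt (5 * δ))
      (isCompact_infDist_le hK hne (3 * δ))
      (fun x (hx : D x ≤ 3 * δ) => lt_of_le_of_lt hx (by linarith)) contDiffOn_const
  have hκ0 {x : Mn n m} (hx : 5 * δ ≤ D x) : κ x = 0 := by
    by_contra h
    have : D x < 5 * δ := hκs (subset_tsupport _ h)
    linarith
  -- the slice kernel
  obtain ⟨N, ψ, R, hk⟩ := exists_isMeanKernel (volume : Measure (Fin (m + 1) → ℝ))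
    (Pi.basisFun ℝ (Fin (m + 1)))
  have hR := hk.pos
  set ρ := δ / R with hρ
  have hρ0 : 0 < ρ := by positivity
  set L := blockIncl (n := n) m j₀ ρ with hL
  have hLn {y : Fin (m + 1) → ℝ} (hy : y ∈ closedBall (0 : Fin (m + 1) → ℝ) R) :
      ‖L y‖ ≤ δ := by
    rw [hL, norm_blockIncl _ hρ0.le]
    rw [mem_closedBall_zero_iff] at hy
    calc ρ * ‖y‖ ≤ ρ * R := by gcongr
      _ = δ := by rw [hρ]; field_simp
  set e : Fin (m + 1) → Mn n m := fun s => L (Pi.basisFun ℝ (Fin (m + 1)) s) with he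
  have hfe : IsHarmonicFamily e f (Ω \ K) := by
    have : e = fun s => ρ • blockFam j₀ s := funext fun s => blockIncl_basisFun j₀ ρ s
    rw [this]
    exact (hf j₀).smul_family ρ
  set η := lapFamily (Pi.basisFun ℝ (Fin (m + 1))) N with hη
  -- the truncated Laplacians
  set g : Mn n m → 𝔸 := fun x => κ x • lapFamily e u x with hg
  set φ : Mn n m → 𝔸 := fun x => κ x • lapFamily (coordBasis n m) u x with hφ
  have hgs : ContDiff ℝ ∞ g := hκ.smul (hu.lapFamily e)
  have hg0 {x : Mn n m} (hx : 2 * δ ≤ D x) : g x = 0 := by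
    rcases le_or_gt (D x) (6 * δ) with h | h
    · simp only [hg]
      rw [lapFamily_congr (huf' hx h), hfe.2 x (hmem hx h), smul_zero]
    · simp only [hg]
      rw [hκ0 (by linarith), zero_smul]
  have hφ0 {x : Mn n m} (hx : 2 * δ ≤ D x) : φ x = 0 := by
    rcases le_or_gt (D x) (6 * δ) with h | h
    · simp only [hφ]
      rw [lapFamily_congr (huf' hx h), hfc.2 x (hmem hx h), smul_zero]
    · simp only [hφ]
      rw [hκ0 (by linarith), zero_smul]
  have hφs : ContDiff ℝ ∞ φ := hκ.smul (hu.lapFamily _)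
  have hsupp {q : Mn n m → 𝔸} (hq : ∀ x, 2 * δ ≤ D x → q x = 0) : HasCompactSupport q :=
    HasCompactSupport.intro (isCompact_infDist_le hK hne (2 * δ)) fun x hx =>
      hq x (le_of_lt (not_le.1 hx))
  have hgc : HasCompactSupport g := hsupp fun _ => hg0
  have hφc : HasCompactSupport φ := hsupp fun _ => hφ0
  have hκ1' {x : Mn n m} (hx : D x < 3 * δ) : κ =ᶠ[𝓝 x] fun _ => 1 := by
    filter_upwards [hV'.mem_nhds (hCV' hx.le)] with y hy using hκ1 hy
  have hcomm (x : Mn n m) : lapFamily (coordBasis n m) g x = lapFamily e φ x := by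
    rcases lt_or_ge (D x) (3 * δ) with h | h
    · have h1 : g =ᶠ[𝓝 x] lapFamily e u := by
        filter_upwards [hκ1' h] with y hy
        simp [hg, hy]
      have h2 : φ =ᶠ[𝓝 x] lapFamily (coordBasis n m) u := by
        filter_upwards [hκ1' h] with y hy
        simp [hφ, hy]
      rw [lapFamily_congr h1, lapFamily_congr h2, lapFamily_comm hu]
    · have h1 : ∀ᶠ y in 𝓝 x, 2 * δ < D y :=
        (hgt (2 * δ)).mem_nhds (show 2 * δ < D x by linarith)
      rw [lapFamily_congr (show g =ᶠ[𝓝 x] fun _ => 0 from h1.mono fun y hy => hg0 hy.le),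
        lapFamily_congr (show φ =ᶠ[𝓝 x] fun _ => 0 from h1.mono fun y hy => hφ0 hy.le),
        lapFamily_zero, lapFamily_zero]
  have hinj : Function.Injective L := blockIncl_injective j₀ hρ0
  -- the solution `h` of `Δ h = φ` obtained by integrating along slices
  set h : Mn n m → 𝔸 := slideInt volume N L g with hh
  have hhs : ContDiff ℝ ∞ h := contDiff_slideInt volume hk.contDiff hgs (Or.inr ⟨hgc, hinj⟩)
  have hhl (x : Mn n m) : lapFamily (coordBasis n m) h x = slideInt volume η L φ x := by
    rw [hh, lapFamily_slideInt volume (hk.contDiff.of_le (by simp)) hgs (Or.inr ⟨hgc, hinj⟩),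
      funext hcomm]
    exact slideInt_lapFamily_right volume hk.contDiff hφs (Or.inr ⟨hφc, hinj⟩) _ x
  have hηs : ContDiff ℝ ∞ η := hk.contDiff.lapFamily _
  have hηu : SlideSupport η L u := Or.inl hk.hasCompactSupport_lap
  set F₀ : Mn n m → 𝔸 := fun x => slideInt volume η L u x - h x with hF₀
  have hus : ContDiff ℝ ∞ (slideInt volume η L u) := contDiff_slideInt volume hηs hu hηu
  have hF₀h : IsHarmonicFamily (coordBasis n m) F₀ {x | D x < 5 * δ} := by
    refine ⟨fun x _ => (hus.sub hhs).contDiffAt, fun x hx => ?_⟩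
    rw [hF₀, lapFamily_sub hus hhs, hhl, lapFamily_slideInt volume (hηs.of_le (by simp)) hu hηu,
      sub_eq_zero]
    refine slideInt_congr hk.lap_eq_zero fun y hy => ?_
    have h1 : D (x + L y) < 6 * δ := by
      have := (abs_le.1 ((hDl x (L y)).trans (hLn hy))).2
      have : D x < 5 * δ := hx
      linarith
    rcases lt_or_ge (D (x + L y)) (3 * δ) with h3 | h3
    · simp [hφ, (hκ1' h3).eq_of_nhds]
    · rw [hφ0 (by linarith), lapFamily_congr (huf' (by linarith) h1.le),
        hfc.2 _ (hmem (by linarith) h1.le)]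
  have hO₁ : IsOpen (Ω ∩ {x | 3 * δ < D x}) := hΩ.inter (hgt _)
  have hhh : IsHarmonicFamily (coordBasis n m) h (Ω ∩ {x | 3 * δ < D x}) := by
    refine ⟨fun x _ => hhs.contDiffAt, fun x hx => ?_⟩
    rw [hhl]
    refine (slideInt_congr (w := fun _ => (0 : 𝔸)) hk.lap_eq_zero fun y hy => hφ0 ?_).trans
      (by simp [slideInt])
    have := (abs_le.1 ((hDl x (L y)).trans (hLn hy))).1
    have : 3 * δ < D x := hx.2
    linarith
  have hF₁h : IsHarmonicFamily (coordBasis n m) (fun x => f x - h x)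
      (Ω ∩ {x | 3 * δ < D x}) :=
    (hfc.mono fun x hx => ⟨hx.1, hDK (lt_trans (by linarith) hx.2)⟩).sub hhh hO₁
  have heq {x : Mn n m} (h3 : 3 * δ < D x) (h5 : D x < 5 * δ) : F₀ x = f x - h x := by
    have hO : IsOpen ({x | 2 * δ < D x} ∩ {x | D x < 6 * δ}) := (hgt _).inter (hlt _)
    have hue : IsHarmonicFamily e u ({x | 2 * δ < D x} ∩ {x | D x < 6 * δ}) :=
      (hfe.mono fun x hx => hmem (le_of_lt hx.1) (le_of_lt hx.2)).congr
        fun x hx => huf' (le_of_lt hx.1) (le_of_lt hx.2)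
    simp only [hF₀]
    rw [hη, hk.slideInt_lap_eq hO hue, (huf' (by linarith) (by linarith)).eq_of_nhds]
    intro t ht y hy
    have h1 : ‖t • L y‖ ≤ δ := by
      rw [norm_smul, Real.norm_of_nonneg ht.1]
      exact (mul_le_of_le_one_left (norm_nonneg _) ht.2).trans (hLn hy)
    have h2 := abs_le.1 ((hDl x (t • L y)).trans h1)
    exact ⟨show 2 * δ < D _ by linarith [h2.1], show D _ < 6 * δ by linarith [h2.2]⟩
  classical
  set F : Mn n m → 𝔸 := fun x => if D x < 4 * δ then F₀ x else f x - h x with hF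
  have hFF₀ {x : Mn n m} (hx : D x < 5 * δ) : F x = F₀ x := by
    simp only [hF]
    split_ifs with h4
    · rfl
    · rw [heq (by linarith) hx]
  have hFF₁ {x : Mn n m} (hx : 3 * δ < D x) : F x = f x - h x := by
    simp only [hF]
    split_ifs with h4
    · rw [heq hx (by linarith)]
    · rfl
  have hF0 : IsHarmonicFamily (coordBasis n m) F {x | D x < 5 * δ} :=
    hF₀h.congr fun x hx => by
      filter_upwards [(hlt (5 * δ)).mem_nhds hx] with y hy using hFF₀ hy
  have hF1 : IsHarmonicFamily (coordBasis n m) F (Ω ∩ {x | 3 * δ < D x}) :=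
    hF₁h.congr fun x hx => by
      filter_upwards [(hgt (3 * δ)).mem_nhds hx.2] with y hy using hFF₁ hy
  refine ⟨F, ⟨fun x hx => ?_, fun x hx => ?_⟩, ?_⟩
  · rcases lt_or_ge (D x) (5 * δ) with h5 | h5
    · exact hF0.1 x h5
    · exact hF1.1 x ⟨hx, show 3 * δ < D x by linarith⟩
  · rcases lt_or_ge (D x) (5 * δ) with h5 | h5
    · exact hF0.2 x h5
    · exact hF1.2 x ⟨hx, show 3 * δ < D x by linarith⟩
  · have hℓ : Continuous fun x : Mn n m => x j₁ 0 := by fun_prop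
    obtain ⟨k, hkK⟩ := hne
    obtain ⟨p, hp, hpmax⟩ := (isCompact_infDist_le hK ⟨k, hkK⟩ (4 * δ)).exists_isMaxOn
      ⟨k, show infDist k K ≤ _ by rw [infDist_zero_of_mem hkK]; positivity⟩ hℓ.continuousOn
    have hpΩ : p ∈ Ω := hDΩ (lt_of_le_of_lt hp (by linarith))
    have hfar {x : Mn n m} (hx : p j₁ 0 < x j₁ 0) : 4 * δ < D x := by
      by_contra hc
      exact absurd (hpmax (show x ∈ {x | infDist x K ≤ 4 * δ} from not_lt.1 hc)) (not_le.2 hx)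
    refine ⟨Ω ∩ {x | p j₁ 0 < x j₁ 0}, hΩ.inter (isOpen_lt continuous_const hℓ), ?_,
      fun x hx => ⟨hx.1, hDK (lt_trans (by linarith) (hfar hx.2))⟩, fun x hx => ?_⟩
    · have hc : Tendsto (fun t : ℝ => p + t • blockFam (m := m) j₁ 0) (𝓝[>] 0) (𝓝 p) := by
        have : Continuous fun t : ℝ => p + t • blockFam (m := m) j₁ 0 := by fun_prop
        simpa using (this.tendsto 0).mono_left nhdsWithin_le_nhds
      obtain ⟨t, ht, ht0⟩ := ((hc.eventually (hΩ.mem_nhds hpΩ)).and self_mem_nhdsWithin).exists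
      exact ⟨_, ht, by simpa [blockFam] using ht0⟩
    · rw [hFF₁ (lt_trans (by linarith) (hfar hx.2))]
      have hz (y : Fin (m + 1) → ℝ) : g (x + L y) = 0 := by
        refine hg0 (le_of_lt (lt_trans (by linarith) (hfar (x := x + L y) ?_)))
        rw [Pi.add_apply, hL, blockIncl_apply_of_ne hj, add_zero]
        exact hx.2
      simp [hh, slideInt, hz]

end Hartogs

end

/-- **Hartogs extension theorem** (Theorem 5.3): if `n > 1`, `Ω ⊆ M^n` is a domain,
`K ⊆ Ω` is compact with `Ω \ K` connected, then every left monogenic function on `Ω \ K`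
extends to a left monogenic function on `Ω`. -/
theorem hartogs_extension (H : HCAlg 𝔸 m) (hn : 1 < n)
    (Ω : Set (Mn n m)) (hΩo : IsOpen Ω) (hΩc : IsConnected Ω)
    (K : Set (Mn n m)) (hKc : IsCompact K) (hKΩ : K ⊆ Ω)
    (hconn : IsConnected (Ω \ K))
    (f : Mn n m → 𝔸) (hf : ContDiffOn ℝ 1 f (Ω \ K))
    (hmono : ∀ x ∈ Ω \ K, ∀ j : Fin n, dbar H f j x = 0) :
    ∃ F : Mn n m → 𝔸, ContDiffOn ℝ 1 F Ω ∧ (∀ x ∈ Ω, ∀ j : Fin n, dbar H F j x = 0) ∧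
      ∀ x ∈ Ω \ K, F x = f x := by
  have := H.findim
  have : CompleteSpace 𝔸 := FiniteDimensional.complete ℝ 𝔸
  have : Nonempty (Σ _ : Fin n, Fin (m + 1)) := ⟨⟨⟨0, by omega⟩, 0⟩⟩
  rcases Set.eq_empty_or_nonempty K with rfl | hne
  · rw [Set.sdiff_empty] at *
    exact ⟨f, hf, hmono, fun _ _ => rfl⟩
  have hU : IsOpen (Ω \ K) := hΩo.sdiff hKc.isClosed
  have hfh := isHarmonicFamily_of_dbar_eq_zero H (by omega) hU hf hmono
  obtain ⟨F, hF, Y, hY, hYne, hYU, hFY⟩ :=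
    exists_isHarmonicFamily_extension hn hΩo hKc hKΩ hne hfh
  have hfc : IsHarmonicFamily (coordBasis n m) f (Ω \ K) :=
    ⟨(hfh ⟨0, by omega⟩).1, fun x hx => by
      rw [lapFamily_coordBasis]
      exact Finset.sum_eq_zero fun j _ => (hfh j).2 x hx⟩
  have hFf : ∀ x ∈ Ω \ K, F x = f x := fun x hx =>
    sub_eq_zero.1 (IsHarmonicFamily.eqOn_zero (coordBasis n m) hU hconn.isPreconnected
      ((hF.mono Set.sdiff_subset).sub hfc hU) hY hYne hYU
      (fun y hy => sub_eq_zero.2 (hFY y hy)) x hx)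
  refine ⟨F, fun x hx => ((hF.1 x hx).of_le (by simp)).contDiffWithinAt, fun x hx j => ?_, hFf⟩
  have hd : IsHarmonicFamily (coordBasis n m) (dbar H F j) Ω :=
    IsHarmonicFamily.sum (fun s => (hF.fderiv_dir hΩo _).clm_comp hΩo (H.mulV s)) hΩo
  refine IsHarmonicFamily.eqOn_zero (coordBasis n m) hΩo hΩc.isPreconnected hd hU hconn.nonempty
    Set.sdiff_subset (fun z hz => ?_) x hx
  have : Filter.EventuallyEq (nhds z) F f := by
    filter_upwards [hU.mem_nhds hz] with y hy using hFf y hy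
  simpa only [dbar, pd, this.fderiv_eq] using hmono z hz j

end
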